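/- Let a ∈ (0,1) and s > 0, and suppose the initial set of advantaged individuals satisfies Y_0 = |𝒴_0| = ⌊aN⌋. Then for every c > 0, sup_{0 ≤ t ≤ c} ‖Z_{⌊Nt⌋} − z_t‖ → 0 in probability as N → ∞, where (z_t)_{t≥0} = (y_t, u_t, v_t)_{t≥0} is given by: y_t = F^{-1}(a^{1+s}/(1−a) · e^{st}) where F(x) = x^{1+s}/(1−x) maps [0,1) onto [0,∞); u_t = y_t · a^{(1+s)/(2s)} (1−a)^{−1/(2s)} [ (1−y_t)^{1/(2s)} y_t^{−(1+s)/(2s)} + ∫_a^{y_t} (1−x)^{1/(2s)} x^{−(1+s)/(2s)} (1/2 + 1/(2s(1−x))) dx ]; v_t = (1−y_t) · a^{(1+s)/(2s)} (1−a)^{−1/(2s)} ∫_a^{y_t} (1−x)^{1/(2s)} x^{−(1+s)/(2s)} (1/2 + 1/(2s(1−x))) dx. -/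

import Mathlib

open MeasureTheory Filter

/-- The biparental Moran model with viability selection on a population of size `N`
with selection parameter `s`, realized on a probability space `Ω`.
`W n` is the matrix of genetic weights, `Y n` the set of advantaged individuals,
`mo n`, `fa n`, `ka n` the positions of the mother, father and killed individual
at time step `n`. -/
structure MoranModel (N : ℕ) (s : ℝ) (Ω : Type) [MeasurableSpace Ω] where
  P : Measure Ω
  isProb : IsProbabilityMeasure P
  W : ℕ → Ω → Fin N → Fin N → ℝ
  Y : ℕ → Ω → Finset (Fin N)
  mo : ℕ → Ω → Fin N
  fa : ℕ → Ω → Fin N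
  ka : ℕ → Ω → Fin N
  meas_W : ∀ n, Measurable (W n)
  meas_Y : ∀ n (A : Set (Finset (Fin N))), MeasurableSet (Y n ⁻¹' A)
  meas_mo : ∀ n, Measurable (mo n)
  meas_fa : ∀ n, Measurable (fa n)
  meas_ka : ∀ n, Measurable (ka n)
  W_init : ∀ ω i j, W 0 ω i j = if i = j then (1 : ℝ) else 0
  Y_rec : ∀ n ω, Y (n + 1) ω =
    if mo n ω ∈ Y n ω then insert (ka n ω) (Y n ω) else (Y n ω).erase (ka n ω)
  W_rec : ∀ n ω i j, W (n + 1) ω i j =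
    if i = ka n ω then (W n ω (mo n ω) j + W n ω (fa n ω) j) / 2 else W n ω i j
  /-- Conditionally on the natural filtration of the chain `(W, Y)`, the mother and
  father are uniform on the population, and independently the killed individual `k` is
  chosen with probability proportional to `1 + s` if disadvantaged, `1` if advantaged. -/
  law : ∀ (n : ℕ) (A : Set Ω),
    MeasurableSet[⨆ k ∈ Set.Iic n,
      (MeasurableSpace.comap (W k) inferInstance ⊔ MeasurableSpace.comap (Y k) ⊤)] A →
    ∀ i j k : Fin N,
      (P (A ∩ {ω | mo n ω = i ∧ fa n ω = j ∧ ka n ω = k})).toReal =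
        (1 / (N : ℝ) ^ 2) *
          ∫ ω in A, (1 + s * (if k ∈ Y n ω then 0 else 1)) /
            (((Y n ω).card : ℝ) + (1 + s) * ((N : ℝ) - ((Y n ω).card : ℝ))) ∂P

/-- The natural filtration of the chain `(W, Y)`. -/
def MoranModel.F {N : ℕ} {s : ℝ} {Ω : Type} [MeasurableSpace Ω]
    (M : MoranModel N s Ω) (n : ℕ) : MeasurableSpace Ω :=
  ⨆ k ∈ Set.Iic n,
    (MeasurableSpace.comap (M.W k) inferInstance ⊔ MeasurableSpace.comap (M.Y k) ⊤)


/-- `U n`, the total genetic weight of the initially advantaged ancestors among the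
advantaged individuals at time `n`. -/
noncomputable def MoranModel.U {N : ℕ} {s : ℝ} {Ω : Type} [MeasurableSpace Ω]
    (M : MoranModel N s Ω) (n : ℕ) (ω : Ω) : ℝ :=
  ∑ l ∈ M.Y n ω, ∑ l' ∈ M.Y 0 ω, M.W n ω l l'

/-- `V n`, the total genetic weight of the initially advantaged ancestors among the
disadvantaged individuals at time `n`. -/
noncomputable def MoranModel.V {N : ℕ} {s : ℝ} {Ω : Type} [MeasurableSpace Ω]
    (M : MoranModel N s Ω) (n : ℕ) (ω : Ω) : ℝ :=
  ∑ l ∈ (M.Y n ω)ᶜ, ∑ l' ∈ M.Y 0 ω, M.W n ω l l'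

/-- The rescaled triplet `Zₙ = (Yₙ/N, Uₙ/N, Vₙ/N) ∈ [0,1]³`. -/
noncomputable def MoranModel.Z {N : ℕ} {s : ℝ} {Ω : Type} [MeasurableSpace Ω]
    (M : MoranModel N s Ω) (n : ℕ) (ω : Ω) : ℝ × ℝ × ℝ :=
  (((M.Y n ω).card : ℝ) / N, M.U n ω / N, M.V n ω / N)

/-- The Euclidean norm on `ℝ³`. -/
noncomputable def norm3 (p : ℝ × ℝ × ℝ) : ℝ :=
  Real.sqrt (p.1 ^ 2 + p.2.1 ^ 2 + p.2.2 ^ 2)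

/-- The integral `∫_a^y (1−x)^{1/(2s)} x^{−(1+s)/(2s)} (1/2 + 1/(2s(1−x))) dx`. -/
noncomputable def intI (s a y : ℝ) : ℝ :=
  ∫ x in a..y, (1 - x) ^ (1 / (2 * s)) / x ^ ((1 + s) / (2 * s)) *
    (1 / 2 + 1 / (2 * s) * (1 / (1 - x)))

/-- `u` expressed as a function of `y`:
`u = y ⬝ a^{(1+s)/(2s)} (1−a)^{−1/(2s)} [(1−y)^{1/(2s)} y^{−(1+s)/(2s)} + ∫_a^y ⋯ dx]`. -/
noncomputable def uval (s a y : ℝ) : ℝ :=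
  y * (a ^ ((1 + s) / (2 * s)) / (1 - a) ^ (1 / (2 * s))) *
    ((1 - y) ^ (1 / (2 * s)) / y ^ ((1 + s) / (2 * s)) + intI s a y)

/-- `v` expressed as a function of `y`:
`v = (1−y) ⬝ a^{(1+s)/(2s)} (1−a)^{−1/(2s)} ∫_a^y ⋯ dx`. -/
noncomputable def vval (s a y : ℝ) : ℝ :=
  (1 - y) * (a ^ ((1 + s) / (2 * s)) / (1 - a) ^ (1 / (2 * s))) * intI s a y

noncomputable def mB1 (s y : ℝ) : ℝ := y - y / (1 + s * (1 - y))
noncomputable def mB2 (s y u v : ℝ) : ℝ := -(u / (1 + s * (1 - y))) + (u + y * (u + v)) / 2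
noncomputable def mB3 (s y u v : ℝ) : ℝ :=
  -((1 + s) * (v / (1 + s * (1 - y)))) + (v + (1 - y) * (u + v)) / 2

noncomputable def mG (s x : ℝ) : ℝ := (1 + s) * Real.log x - Real.log (1 - x)

lemma mG_expand {s x x' : ℝ} (hs : 0 < s) (hx : 0 < x) (hxx : x ≤ x') (hx' : x' < 1) :
    x' - x ≤ mG s x' - mG s x := by
  unfold mG
  have h0 : 0 < x' := hx.trans_le hxx
  have h1 : Real.log (x / x') ≤ x / x' - 1 := Real.log_le_sub_one_of_pos (by positivity)
  rw [Real.log_div hx.ne' h0.ne'] at h1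
  have h2 : Real.log (1 - x') ≤ Real.log (1 - x) := Real.log_le_log (by linarith) (by linarith)
  have h3 : x' - x ≤ 1 - x / x' := by
    rw [one_sub_div h0.ne', le_div_iff₀ h0]
    nlinarith
  have h4 : Real.log x ≤ Real.log x' := Real.log_le_log hx hxx
  nlinarith

lemma mG_expand_abs {s x x' : ℝ} (hs : 0 < s) (hx : x ∈ Set.Ioo (0:ℝ) 1) (hx' : x' ∈ Set.Ioo (0:ℝ) 1) :
    |x' - x| ≤ |mG s x' - mG s x| := by
  rcases le_total x x' with h | h
  · have := mG_expand hs hx.1 h hx'.2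
    rw [abs_of_nonneg (by linarith), abs_of_nonneg (by linarith)]; exact this
  · have := mG_expand hs hx'.1 h hx.2
    rw [abs_sub_comm, abs_sub_comm (mG s x'), abs_of_nonneg (by linarith), abs_of_nonneg (by linarith)]; exact this

lemma mG_hasDerivAt {s x : ℝ} (hx : x ∈ Set.Ioo (0:ℝ) 1) :
    HasDerivAt (mG s) ((1 + s * (1 - x)) / (x * (1 - x))) x := by
  have h1 : x ≠ 0 := hx.1.ne'
  have h2 : 1 - x ≠ 0 := by have := hx.2; linarith
  have := ((Real.hasDerivAt_log h1).const_mul (1 + s)).sub (((hasDerivAt_id x).const_sub 1).log h2)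
  refine this.congr_deriv ?_
  simp only [id]
  field_simp
  ring

lemma mG_surj {s : ℝ} (hs : 0 < s) (r : ℝ) : ∃ x ∈ Set.Ioo (0:ℝ) 1, mG s x = r := by
  have hc : ContinuousOn (mG s) (Set.Ioo 0 1) := fun x hx =>
    (mG_hasDerivAt hx).continuousAt.continuousWithinAt
  -- low point
  have key : Set.SurjOn (mG s) (Set.Ioo 0 1) Set.univ := by
    have hne : (Set.Ioo (0:ℝ) 1).Nonempty := ⟨1/2, by norm_num⟩
    have l0 : Tendsto (mG s) (nhdsWithin 0 (Set.Ioi 0)) atBot := by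
      unfold mG
      have h1 : Tendsto (fun x : ℝ => (1 + s) * Real.log x) (nhdsWithin 0 (Set.Ioi 0)) atBot :=
        Real.tendsto_log_nhdsGT_zero.const_mul_atBot (by linarith)
      have h2 : Tendsto (fun x : ℝ => Real.log (1 - x)) (nhdsWithin 0 (Set.Ioi 0)) (nhds (Real.log (1-0))) := by
        apply Tendsto.mono_left _ nhdsWithin_le_nhds
        have : ContinuousAt (fun x : ℝ => Real.log (1 - x)) 0 := by
          apply ContinuousAt.log (by fun_prop); norm_num
        exact this
      simp only [sub_eq_add_neg]
      exact h1.atBot_add (h2.neg)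
    have l1 : Tendsto (mG s) (nhdsWithin 1 (Set.Iio 1)) atTop := by
      unfold mG
      have h1 : Tendsto (fun x : ℝ => (1 + s) * Real.log x) (nhdsWithin 1 (Set.Iio 1)) (nhds ((1 + s) * Real.log 1)) := by
        apply Tendsto.mono_left _ nhdsWithin_le_nhds
        have : ContinuousAt (fun x : ℝ => (1 + s) * Real.log x) 1 := by
          apply ContinuousAt.mul (by fun_prop)
          apply ContinuousAt.log (by fun_prop); norm_num
        exact this
      have h2 : Tendsto (fun x : ℝ => Real.log (1 - x)) (nhdsWithin 1 (Set.Iio 1)) atBot := by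
        apply Real.tendsto_log_nhdsGT_zero.comp
        apply tendsto_nhdsWithin_of_tendsto_nhds_of_eventually_within
        · apply Tendsto.mono_left _ nhdsWithin_le_nhds
          have : ContinuousAt (fun x : ℝ => (1 - x)) 1 := by fun_prop
          simpa [ContinuousAt] using this
        · filter_upwards [self_mem_nhdsWithin] with x hx
          simpa using hx
      simp only [sub_eq_add_neg]
      exact h1.add_atTop (tendsto_neg_atBot_atTop.comp h2)
    intro r _
    obtain ⟨A, hA⟩ := ((l0.eventually (eventually_le_atBot r)).and
      (Ioo_mem_nhdsGT (show (0:ℝ) < 1/2 by norm_num))).exists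
    obtain ⟨B, hB⟩ := ((l1.eventually (eventually_ge_atTop r)).and
      (Ioo_mem_nhdsLT (show (1/2:ℝ) < 1 by norm_num))).exists
    have hsub : Set.Icc A B ⊆ Set.Ioo 0 1 := fun x hx =>
      ⟨hA.2.1.trans_le hx.1, hx.2.trans_lt hB.2.2⟩
    have := intermediate_value_Icc (by linarith [hA.2.2, hB.2.1]) (hc.mono hsub)
    obtain ⟨x, hx, h⟩ := this ⟨hA.1, hB.1⟩
    exact ⟨x, hsub hx, h⟩
  exact key (Set.mem_univ r)

lemma mG_eq_of_F {s a x t : ℝ} (hs : 0 < s) (ha : a ∈ Set.Ioo (0:ℝ) 1) (hx : x ∈ Set.Ico (0:ℝ) 1)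
    (h : x ^ (1 + s) / (1 - x) = a ^ (1 + s) / (1 - a) * Real.exp (s * t)) :
    x ∈ Set.Ioo (0:ℝ) 1 ∧ mG s x = mG s a + s * t := by
  have ha0 := ha.1
  have ha1 : 0 < 1 - a := by linarith [ha.2]
  have hx1 : 0 < 1 - x := by linarith [hx.2]
  have hx0 : 0 < x := by
    rcases hx.1.eq_or_lt with h0 | h0
    · exfalso
      rw [← h0, Real.zero_rpow (by linarith)] at h
      have : 0 < a ^ (1 + s) / (1 - a) * Real.exp (s * t) := by positivity
      rw [zero_div] at h; linarith
    · exact h0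
  refine ⟨⟨hx0, hx.2⟩, ?_⟩
  have := congrArg Real.log h
  rw [Real.log_mul (by positivity) (by positivity), Real.log_div (by positivity) (by positivity),
    Real.log_div (by positivity) (by positivity), Real.log_rpow hx0, Real.log_rpow ha0,
    Real.log_exp] at this
  exact this

noncomputable def mg (s x : ℝ) : ℝ := (1 - x) ^ (1 / (2 * s)) / x ^ ((1 + s) / (2 * s))

lemma mg_eq_exp {s x : ℝ} (hs : 0 < s) (hx : x ∈ Set.Ioo (0:ℝ) 1) :
    mg s x = Real.exp (-(mG s x) / (2 * s)) := by
  have hx1 : 0 < 1 - x := by linarith [hx.2]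
  unfold mg mG
  rw [Real.rpow_def_of_pos hx1, Real.rpow_def_of_pos hx.1, ← Real.exp_sub]
  congr 1
  field_simp
  ring

lemma intI_hasDerivAt {s a x : ℝ} (hs : 0 < s) (ha : a ∈ Set.Ioo (0:ℝ) 1) (hx : x ∈ Set.Ioo (0:ℝ) 1) :
    HasDerivAt (intI s a) (mg s x * (1 / 2 + 1 / (2 * s) * (1 / (1 - x)))) x := by
  have hcont : ContinuousOn (fun x : ℝ => (1 - x) ^ (1 / (2 * s)) / x ^ ((1 + s) / (2 * s)) *
    (1 / 2 + 1 / (2 * s) * (1 / (1 - x)))) (Set.Ioo 0 1) := by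
    intro z hz
    have h1 : z ≠ 0 := hz.1.ne'
    have h2 : 1 - z ≠ 0 := by have := hz.2; linarith
    apply ContinuousAt.continuousWithinAt
    apply ContinuousAt.mul
    · apply ContinuousAt.div
      · exact ContinuousAt.rpow_const (by fun_prop) (Or.inl h2)
      · exact ContinuousAt.rpow_const (by fun_prop) (Or.inl h1)
      · exact (Real.rpow_pos_of_pos hz.1 _).ne'
    · apply ContinuousAt.add (by fun_prop)
      apply ContinuousAt.mul (by fun_prop)
      exact ContinuousAt.div (by fun_prop) (by fun_prop) h2
  unfold intI
  apply intervalIntegral.integral_hasDerivAt_right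
  · apply ContinuousOn.intervalIntegrable
    apply hcont.mono
    exact Set.OrdConnected.uIcc_subset Set.ordConnected_Ioo ha hx
  · exact hcont.stronglyMeasurableAtFilter isOpen_Ioo x hx
  · exact hcont.continuousAt (isOpen_Ioo.mem_nhds hx)

lemma mY_hasDerivAt {s a : ℝ} (hs : 0 < s) (f : ℝ → ℝ) (hf : ∀ t, f t ∈ Set.Ioo (0:ℝ) 1)
    (hG : ∀ t, mG s (f t) = mG s a + s * t) (t : ℝ) :
    HasDerivAt f (mB1 s (f t)) t := by
  have hcont : Continuous f := by
    have : LipschitzWith (Real.toNNReal s) f := by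
      apply LipschitzWith.of_dist_le_mul
      intro t r
      rw [Real.dist_eq, Real.dist_eq, Real.coe_toNNReal _ hs.le]
      have := mG_expand_abs hs (hf r) (hf t)
      rw [hG, hG] at this
      have e : mG s a + s * t - (mG s a + s * r) = s * (t - r) := by ring
      rwa [e, abs_mul, abs_of_pos hs] at this
    exact this.continuous
  have h1 := mG_hasDerivAt (s := s) (hf t)
  have hx0 := (hf t).1
  have hx1 : 0 < 1 - f t := by linarith [(hf t).2]
  have h2 : HasDerivAt (fun x => (mG s x - mG s a) / s) ((1 + s * (1 - f t)) / (f t * (1 - f t)) / s) (f t) :=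
    (h1.sub_const _).div_const s
  have h3 := HasDerivAt.of_local_left_inverse (g := f) (a := t) (f := fun x => (mG s x - mG s a) / s)
    hcont.continuousAt h2 (by positivity) (Eventually.of_forall fun r => by
      simp only [hG]; field_simp; ring)
  refine h3.congr_deriv ?_
  unfold mB1
  field_simp
  ring

lemma mODE (s a : ℝ) (hs : 0 < s) (ha : a ∈ Set.Ioo (0 : ℝ) 1) (y : ℝ → ℝ)
    (hy : ∀ t : ℝ, 0 ≤ t → y t ∈ Set.Ico (0 : ℝ) 1 ∧
      (y t) ^ (1 + s) / (1 - y t) = a ^ (1 + s) / (1 - a) * Real.exp (s * t)) :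
    ∃ f g h : ℝ → ℝ, (∀ t, 0 ≤ t → y t = f t ∧ uval s a (y t) = g t ∧ vval s a (y t) = h t) ∧
      (∀ t, HasDerivAt f (mB1 s (f t)) t) ∧ (∀ t, HasDerivAt g (mB2 s (f t) (g t) (h t)) t) ∧
      (∀ t, HasDerivAt h (mB3 s (f t) (g t) (h t)) t) ∧
      (∀ t, 0 ≤ t → f t ∈ Set.Icc (0:ℝ) 1 ∧ g t ∈ Set.Icc (0:ℝ) 1 ∧ h t ∈ Set.Icc (0:ℝ) 1) ∧
      f 0 = a ∧ g 0 = a ∧ h 0 = 0 := by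
  choose f hf hG using fun t : ℝ => mG_surj hs (mG s a + s * t)
  have hinj : ∀ {x x'}, x ∈ Set.Ioo (0:ℝ) 1 → x' ∈ Set.Ioo (0:ℝ) 1 → mG s x' = mG s x → x' = x := by
    intro x x' hx hx' h
    have := mG_expand_abs hs hx hx'
    rw [h, sub_self, abs_zero] at this
    have := abs_nonpos_iff.mp this
    linarith
  have hyf : ∀ t, 0 ≤ t → y t = f t := by
    intro t ht
    obtain ⟨h1, h2⟩ := hy t ht
    obtain ⟨h3, h4⟩ := mG_eq_of_F hs ha h1 h2
    exact hinj (hf t) h3 (by rw [h4, hG])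
  have hf0 : f 0 = a := hinj ha (hf 0) (by rw [hG]; ring)
  have hfd := mY_hasDerivAt hs f hf hG
  set C := a ^ ((1 + s) / (2 * s)) / (1 - a) ^ (1 / (2 * s)) with hC
  have hCg : ∀ t, C * mg s (f t) = Real.exp (-t/2) := by
    intro t
    have e1 : C = (mg s a)⁻¹ := by rw [hC, mg, inv_div]
    rw [e1, mg_eq_exp hs ha, mg_eq_exp hs (hf t), ← Real.exp_neg, ← Real.exp_add, hG]
    congr 1
    field_simp
    ring
  set q : ℝ → ℝ := fun t => C * intI s a (f t) with hq
  have hqd : ∀ t, HasDerivAt q (f t * Real.exp (-t/2) / 2) t := by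
    intro t
    have h1 := ((intI_hasDerivAt hs ha (hf t)).comp t (hfd t)).const_mul C
    refine h1.congr_deriv ?_
    rw [← hCg t]
    have hx0 := (hf t).1
    have hx1 : 0 < 1 - f t := by linarith [(hf t).2]
    have : 0 < 1 + s * (1 - f t) := by positivity
    unfold mB1
    field_simp
    ring
  have hed : ∀ t : ℝ, HasDerivAt (fun t => Real.exp (-t/2)) (-(Real.exp (-t/2) / 2)) t := by
    intro t
    have := (((hasDerivAt_id' t).fun_neg).div_const 2).exp
    refine this.congr_deriv ?_
    ring
  have hq0 : q 0 = 0 := by simp [hq, hf0, intI]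
  have hqnn : ∀ t, 0 ≤ t → 0 ≤ q t := by
    intro t ht
    have : Monotone q := monotone_of_hasDerivAt_nonneg hqd (fun t => by
      have := (hf t).1; positivity)
    have := this ht
    rwa [hq0] at this
  have hq1 : ∀ t, 0 ≤ t → Real.exp (-t/2) + q t ≤ 1 := by
    intro t ht
    have : Antitone (fun t => Real.exp (-t/2) + q t) := antitone_of_hasDerivAt_nonpos (fun t => (hed t).add (hqd t)) (fun t => by
      have := (hf t).2
      have := Real.exp_pos (-t/2)
      simp only [Pi.zero_apply]
      nlinarith)
    have := this ht
    simpa [hq0] using this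
  refine ⟨f, fun t => f t * (Real.exp (-t/2) + q t), fun t => (1 - f t) * q t, ?_, hfd, ?_, ?_, ?_, hf0, ?_, ?_⟩
  · intro t ht
    refine ⟨hyf t ht, ?_, ?_⟩
    · simp only [hyf t ht, ← hCg t]
      simp only [uval, mg, hq, ← hC]; ring
    · rw [hyf t ht]
      simp only [vval, hq, ← hC]; ring
  · intro t
    refine ((hfd t).mul ((hed t).add (hqd t))).congr_deriv ?_
    have hx1 : 0 < 1 - f t := by linarith [(hf t).2]
    have : 0 < 1 + s * (1 - f t) := by positivity
    simp only [mB1, mB2, Pi.add_apply]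
    field_simp
    ring
  · intro t
    refine (((hfd t).const_sub 1).mul (hqd t)).congr_deriv ?_
    have hx1 : 0 < 1 - f t := by linarith [(hf t).2]
    have : 0 < 1 + s * (1 - f t) := by positivity
    simp only [mB1, mB3]
    field_simp
    ring
  · intro t ht
    have a1 := hf t
    have a2 := hqnn t ht
    have a3 := hq1 t ht
    have a4 := Real.exp_pos (-t/2)
    refine ⟨⟨a1.1.le, a1.2.le⟩, ⟨?_, ?_⟩, ⟨?_, ?_⟩⟩
    · have := a1.1; positivity
    · nlinarith [a1.1, a1.2]
    · exact mul_nonneg (by linarith [a1.2]) a2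
    · nlinarith [a1.1, a1.2]
  · simp [hq0, hf0]
  · simp [hq0]

lemma m_frac {s x x' y y' : ℝ} (hs : 0 < s) (hx' : x' ∈ Set.Icc (0:ℝ) 1)
    (hy : y ∈ Set.Icc (0:ℝ) 1) (hy' : y' ∈ Set.Icc (0:ℝ) 1) :
    |x / (1 + s * (1 - y)) - x' / (1 + s * (1 - y'))| ≤ |x - x'| + s * |y - y'| := by
  have hD : 1 ≤ 1 + s * (1 - y) := by nlinarith [hy.2]
  have hD' : 1 ≤ 1 + s * (1 - y') := by nlinarith [hy'.2]
  have e : x / (1 + s * (1 - y)) - x' / (1 + s * (1 - y')) =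
      (x - x') / (1 + s * (1 - y)) + x' * (s * (y - y')) / ((1 + s * (1 - y)) * (1 + s * (1 - y'))) := by
    field_simp
    ring
  rw [e]
  refine (abs_add_le _ _).trans (add_le_add ?_ ?_)
  · rw [abs_div, abs_of_pos (by linarith : 0 < 1 + s * (1 - y))]
    exact div_le_self (abs_nonneg _) hD
  · rw [abs_div, abs_of_pos (by positivity : 0 < (1 + s * (1 - y)) * (1 + s * (1 - y')))]
    refine (div_le_self (abs_nonneg _) (by nlinarith)).trans ?_
    rw [abs_mul, abs_mul, abs_of_pos hs, abs_of_nonneg hx'.1]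
    exact mul_le_of_le_one_left (by positivity) hx'.2

lemma m_prod {x x' y y' : ℝ} (hx : x ∈ Set.Icc (0:ℝ) 1) (hy' : y' ∈ Set.Icc (0:ℝ) 1) :
    |y * x - y' * x'| ≤ |y - y'| + |x - x'| := by
  have e : y * x - y' * x' = (y - y') * x + y' * (x - x') := by ring
  rw [e]
  refine (abs_add_le _ _).trans (add_le_add ?_ ?_)
  · rw [abs_mul, abs_of_nonneg hx.1]; exact mul_le_of_le_one_right (abs_nonneg _) hx.2
  · rw [abs_mul, abs_of_nonneg hy'.1]; exact mul_le_of_le_one_left (abs_nonneg _) hy'.2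

noncomputable def mL (s : ℝ) : ℝ := (1 + s) ^ 2 + 2

lemma mB1_lip {s y u v y' u' v' : ℝ} (hs : 0 < s) (hy : y ∈ Set.Icc (0:ℝ) 1) (hy' : y' ∈ Set.Icc (0:ℝ) 1) :
    |mB1 s y - mB1 s y'| ≤ mL s * (|y - y'| + |u - u'| + |v - v'|) := by
  have h1 := m_frac (x := y) hs hy' hy hy'
  have e : mB1 s y - mB1 s y' = (y - y') - (y / (1 + s * (1 - y)) - y' / (1 + s * (1 - y'))) := by
    unfold mB1; ring
  rw [e]
  refine (abs_sub _ _).trans ?_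
  unfold mL
  nlinarith [abs_nonneg (y - y'), abs_nonneg (u - u'), abs_nonneg (v - v'), mul_pos hs hs,
    mul_nonneg hs.le (abs_nonneg (y - y')), mul_nonneg (mul_pos hs hs).le (abs_nonneg (y - y')),
    mul_nonneg (sq_nonneg (1+s)) (abs_nonneg (u - u')), mul_nonneg (sq_nonneg (1+s)) (abs_nonneg (v - v'))]

lemma mB2_lip {s y u v y' u' v' : ℝ} (hs : 0 < s) (hy : y ∈ Set.Icc (0:ℝ) 1) (hy' : y' ∈ Set.Icc (0:ℝ) 1)
    (hu : u ∈ Set.Icc (0:ℝ) 1) (hu' : u' ∈ Set.Icc (0:ℝ) 1) (hv : v ∈ Set.Icc (0:ℝ) 1) :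
    |mB2 s y u v - mB2 s y' u' v'| ≤ mL s * (|y - y'| + |u - u'| + |v - v'|) := by
  have h1 := m_frac (x := u) hs hu' hy hy'
  have h2 := m_prod (x' := u') (y := y) hu hy'
  have h3 := m_prod (x' := v') (y := y) hv hy'
  have e : mB2 s y u v - mB2 s y' u' v' = -(u / (1 + s * (1 - y)) - u' / (1 + s * (1 - y')))
    + ((u - u') + (y * u - y' * u') + (y * v - y' * v')) / 2 := by
    unfold mB2; ring
  have h4 : |mB2 s y u v - mB2 s y' u' v'| ≤ (|u - u'| + s * |y - y'|) + (|u - u'| + (|y - y'| + |u - u'|) + (|y - y'| + |v - v'|)) / 2 := by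
    rw [e]
    refine (abs_add_le _ _).trans (add_le_add (by rwa [abs_neg]) ?_)
    rw [abs_div, abs_two]
    gcongr
    exact (abs_add_three _ _ _).trans (by gcongr)
  refine h4.trans ?_
  unfold mL
  nlinarith [abs_nonneg (y - y'), abs_nonneg (u - u'), abs_nonneg (v - v'), mul_pos hs hs,
    mul_nonneg hs.le (abs_nonneg (y - y')), mul_nonneg (mul_pos hs hs).le (abs_nonneg (y - y')),
    mul_nonneg (sq_nonneg (1+s)) (abs_nonneg (u - u')), mul_nonneg (sq_nonneg (1+s)) (abs_nonneg (v - v'))]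

lemma mB3_lip {s y u v y' u' v' : ℝ} (hs : 0 < s) (hy : y ∈ Set.Icc (0:ℝ) 1) (hy' : y' ∈ Set.Icc (0:ℝ) 1)
    (hu : u ∈ Set.Icc (0:ℝ) 1) (hv : v ∈ Set.Icc (0:ℝ) 1) (hv' : v' ∈ Set.Icc (0:ℝ) 1) :
    |mB3 s y u v - mB3 s y' u' v'| ≤ mL s * (|y - y'| + |u - u'| + |v - v'|) := by
  have h1 := m_frac (x := v) hs hv' hy hy'
  have h2 := m_prod (x := u) (x' := u') (y := 1 - y) (y' := 1 - y') hu ⟨by linarith [hy'.2], by linarith [hy'.1]⟩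
  have h3 := m_prod (x := v) (x' := v') (y := 1 - y) (y' := 1 - y') hv ⟨by linarith [hy'.2], by linarith [hy'.1]⟩
  have ee : |1 - y - (1 - y')| = |y - y'| := by rw [abs_sub_comm]; congr 1; ring
  rw [ee] at h2 h3
  have e : mB3 s y u v - mB3 s y' u' v' = -((1 + s) * (v / (1 + s * (1 - y)) - v' / (1 + s * (1 - y'))))
    + ((v - v') + ((1 - y) * u - (1 - y') * u') + ((1 - y) * v - (1 - y') * v')) / 2 := by
    unfold mB3; ring
  have h4 : |mB3 s y u v - mB3 s y' u' v'| ≤ (1 + s) * (|v - v'| + s * |y - y'|) + (|v - v'| + (|y - y'| + |u - u'|) + (|y - y'| + |v - v'|)) / 2 := by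
    rw [e]
    refine (abs_add_le _ _).trans (add_le_add ?_ ?_)
    · rw [abs_neg, abs_mul, abs_of_pos (by linarith : 0 < 1 + s)]
      gcongr
    rw [abs_div, abs_two]
    gcongr
    exact (abs_add_three _ _ _).trans (by gcongr)
  refine h4.trans ?_
  unfold mL
  nlinarith [abs_nonneg (y - y'), abs_nonneg (u - u'), abs_nonneg (v - v'), mul_pos hs hs,
    mul_nonneg hs.le (abs_nonneg (y - y')), mul_nonneg (mul_pos hs hs).le (abs_nonneg (y - y')),
    mul_nonneg hs.le (abs_nonneg (v - v')), mul_nonneg (mul_pos hs hs).le (abs_nonneg (v - v')),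
    mul_nonneg (sq_nonneg (1+s)) (abs_nonneg (u - u'))]

lemma m_frac_bd {s x y : ℝ} (hs : 0 < s) (hx : x ∈ Set.Icc (0:ℝ) 1)
    (hy : y ∈ Set.Icc (0:ℝ) 1) : x / (1 + s * (1 - y)) ∈ Set.Icc (0:ℝ) 1 := by
  have hD : 1 ≤ 1 + s * (1 - y) := by nlinarith [hy.2]
  exact ⟨div_nonneg hx.1 (by linarith), (div_le_self hx.1 hD).trans hx.2⟩

lemma mB_bd {s y u v : ℝ} (hs : 0 < s) (hy : y ∈ Set.Icc (0:ℝ) 1)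
    (hu : u ∈ Set.Icc (0:ℝ) 1) (hv : v ∈ Set.Icc (0:ℝ) 1) :
    |mB1 s y| ≤ 3 + s ∧ |mB2 s y u v| ≤ 3 + s ∧ |mB3 s y u v| ≤ 3 + s := by
  have h1 := m_frac_bd hs hy hy
  have h2 := m_frac_bd hs hu hy
  have h3 := m_frac_bd hs hv hy
  unfold mB1 mB2 mB3
  obtain ⟨y0, y1⟩ := hy
  obtain ⟨u0, u1⟩ := hu
  obtain ⟨v0, v1⟩ := hv
  have p1 : y * (u + v) ≤ 2 := by nlinarith
  have p2 : 0 ≤ y * (u + v) := by positivity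
  have p3 : 0 ≤ (1 + s) * (v / (1 + s * (1 - y))) := mul_nonneg (by linarith) h3.1
  have p4 : (1 + s) * (v / (1 + s * (1 - y))) ≤ 1 + s := mul_le_of_le_one_right (by linarith) h3.2
  refine ⟨abs_le.2 ⟨?_, ?_⟩, abs_le.2 ⟨?_, ?_⟩, abs_le.2 ⟨?_, ?_⟩⟩ <;> nlinarith [h1.1, h1.2, h2.1, h2.2]

structure MSol (s : ℝ) (f g h : ℝ → ℝ) : Prop where
  d1 : ∀ t, HasDerivAt f (mB1 s (f t)) t
  d2 : ∀ t, HasDerivAt g (mB2 s (f t) (g t) (h t)) t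
  d3 : ∀ t, HasDerivAt h (mB3 s (f t) (g t) (h t)) t
  c1 : ∀ t, 0 ≤ t → f t ∈ Set.Icc (0:ℝ) 1
  c2 : ∀ t, 0 ≤ t → g t ∈ Set.Icc (0:ℝ) 1
  c3 : ∀ t, 0 ≤ t → h t ∈ Set.Icc (0:ℝ) 1

lemma m_lip_of {f f' : ℝ → ℝ} {B : ℝ} (hd : ∀ t, HasDerivAt f (f' t) t) (hb : ∀ t, 0 ≤ t → |f' t| ≤ B)
    {t r : ℝ} (ht : 0 ≤ t) (hr : 0 ≤ r) : |f r - f t| ≤ B * |r - t| := by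
  have := (convex_Ici (0:ℝ)).norm_image_sub_le_of_norm_hasDerivWithin_le
    (f := f) (f' := f') (C := B) (fun x _ => (hd x).hasDerivWithinAt) (fun x hx => hb x hx)
    (x := t) (y := r) ht hr
  simpa using this

lemma m_taylor {f f' : ℝ → ℝ} {K t e : ℝ} (hd : ∀ t, HasDerivAt f (f' t) t) (ht : 0 ≤ t) (he : 0 ≤ e)
    (hK : 0 ≤ K)
    (hb : ∀ t r, 0 ≤ t → 0 ≤ r → |f' r - f' t| ≤ K * |r - t|)
    : |f (t + e) - f t - f' t * e| ≤ K * e ^ 2 := by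
  have := (convex_Icc t (t + e)).norm_image_sub_le_of_norm_hasDerivWithin_le
    (f := fun r => f r - f' t * r) (f' := fun r => f' r - f' t * 1) (C := K * e)
    (fun x _ => ((hd x).sub ((hasDerivAt_id' x).const_mul (f' t))).hasDerivWithinAt) (fun x hx => by
      rw [mul_one, Real.norm_eq_abs]
      refine (hb t x ht (ht.trans hx.1)).trans ?_
      gcongr
      rw [abs_of_nonneg (by linarith [hx.1])]
      linarith [hx.2])
    (x := t) (y := t + e) ⟨le_rfl, by linarith⟩ ⟨by linarith, le_rfl⟩
  rw [Real.norm_eq_abs, Real.norm_eq_abs, add_sub_cancel_left, abs_of_nonneg he] at this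
  calc _ = |f (t + e) - f' t * (t + e) - (f t - f' t * t)| := by congr 1; ring
    _ ≤ _ := this
    _ = _ := by ring

lemma MSol.lip {s : ℝ} {f g h : ℝ → ℝ} (hs : 0 < s) (S : MSol s f g h) {t r : ℝ} (ht : 0 ≤ t) (hr : 0 ≤ r) :
    |f r - f t| ≤ (3 + s) * |r - t| ∧ |g r - g t| ≤ (3 + s) * |r - t| ∧ |h r - h t| ≤ (3 + s) * |r - t| :=
  have hb := fun t ht => mB_bd hs (S.c1 t ht) (S.c2 t ht) (S.c3 t ht)
  ⟨m_lip_of S.d1 (fun t ht => (hb t ht).1) ht hr, m_lip_of S.d2 (fun t ht => (hb t ht).2.1) ht hr,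
    m_lip_of S.d3 (fun t ht => (hb t ht).2.2) ht hr⟩

noncomputable def mK (s : ℝ) : ℝ := mL s * (3 * (3 + s))

lemma MSol.taylor {s : ℝ} {f g h : ℝ → ℝ} (hs : 0 < s) (S : MSol s f g h) {t e : ℝ} (ht : 0 ≤ t) (he : 0 ≤ e) :
    |f (t + e) - f t - mB1 s (f t) * e| ≤ mK s * e ^ 2 ∧
    |g (t + e) - g t - mB2 s (f t) (g t) (h t) * e| ≤ mK s * e ^ 2 ∧
    |h (t + e) - h t - mB3 s (f t) (g t) (h t) * e| ≤ mK s * e ^ 2 := by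
  have hL : 0 ≤ mL s := by unfold mL; positivity
  have hK : 0 ≤ mK s := by unfold mK; positivity
  have key : ∀ t r, 0 ≤ t → 0 ≤ r → mL s * (|f r - f t| + |g r - g t| + |h r - h t|) ≤ mK s * |r - t| := by
    intro t r ht hr
    obtain ⟨h1, h2, h3⟩ := S.lip hs ht hr
    unfold mK
    rw [mul_assoc]
    gcongr
    linarith
  refine ⟨m_taylor S.d1 ht he hK fun t r ht hr => ?_, m_taylor S.d2 ht he hK fun t r ht hr => ?_,
    m_taylor S.d3 ht he hK fun t r ht hr => ?_⟩
  · exact (mB1_lip hs (S.c1 r hr) (S.c1 t ht)).trans (key t r ht hr)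
  · exact (mB2_lip hs (S.c1 r hr) (S.c1 t ht) (S.c2 r hr) (S.c2 t ht) (S.c3 r hr)).trans (key t r ht hr)
  · exact (mB3_lip hs (S.c1 r hr) (S.c1 t ht) (S.c2 r hr) (S.c3 r hr) (S.c3 t ht)).trans (key t r ht hr)

lemma mCoord {ι : Type} [Fintype ι] (p δ : ι → ℝ) (hp : ∀ i, 0 ≤ p i) (hp1 : ∑ i, p i = 1)
    (hδ : ∀ i, |δ i| ≤ 1) {b x z w β n B R : ℝ} (hb : ∑ i, p i * δ i = b) (hn : 1 ≤ n) (hxz : |x - z| ≤ 1)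
    (hβ : |β| ≤ B) (hR : 0 ≤ R) (hw : |w - z - β * (1 / n)| ≤ R * (1 / n) ^ 2) :
    ∑ i, p i * (x + δ i / n - w) ^ 2 ≤ (x - z) ^ 2 + 2 * ((x - z) * (b - β)) / n +
      (2 * R + (B + R + 1) ^ 2) / n ^ 2 := by
  have hn0 : 0 < n := by linarith
  have hδ2 : ∑ i, p i * (δ i) ^ 2 ≤ 1 := by
    rw [← hp1]
    refine Finset.sum_le_sum fun i _ => mul_le_of_le_one_right (hp i) ?_
    rw [← sq_abs]; exact pow_le_one₀ (abs_nonneg _) (hδ i)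
  have hb1 : |b| ≤ 1 := by
    rw [← hb, ← hp1]
    refine (Finset.abs_sum_le_sum_abs _ _).trans (Finset.sum_le_sum fun i _ => ?_)
    rw [abs_mul, abs_of_nonneg (hp i)]
    exact mul_le_of_le_one_right (hp i) (hδ i)
  have e1 : ∑ i, p i * (x + δ i / n - w) ^ 2 = (x - w) ^ 2 + 2 * (x - w) / n * b + (∑ i, p i * (δ i) ^ 2) / n ^ 2 := by
    rw [← hb, Finset.mul_sum, Finset.sum_div]
    rw [← one_mul ((x - w) ^ 2)]
    rw [← hp1, Finset.sum_mul, ← Finset.sum_add_distrib, ← Finset.sum_add_distrib]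
    refine Finset.sum_congr rfl fun i _ => ?_
    field_simp
    ring
  rw [e1]
  -- scaled variables
  set e := 1 / n with he
  have he0 : 0 < e := by positivity
  have he1 : e ≤ 1 := by rw [he, div_le_one hn0]; exact hn
  set ρ := w - z - β * e with hρ
  have h1 : (∑ i, p i * (δ i) ^ 2) / n ^ 2 ≤ e ^ 2 := by
    rw [he, div_pow, one_pow]; gcongr
  have e2 : ∀ c : ℝ, c / n = c * e := fun c => by rw [he]; ring
  have e3 : ∀ c : ℝ, c / n ^ 2 = c * e ^ 2 := fun c => by rw [he]; ring
  have hm : |β * e + ρ| ≤ (B + R) * e := by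
    refine (abs_add_le _ _).trans ?_
    rw [abs_mul, abs_of_pos he0, add_mul]
    refine add_le_add (by gcongr) (hw.trans ?_)
    gcongr
    nlinarith
  have h2 : |(x - z) * ρ| ≤ R * e ^ 2 := by
    rw [abs_mul]
    calc _ ≤ 1 * |ρ| := by gcongr
      _ ≤ _ := by rw [one_mul]; exact hw
  have h3 : |(β * e + ρ) * b| ≤ (B + R) * e := by
    rw [abs_mul]
    calc _ ≤ |β * e + ρ| * 1 := by gcongr
      _ ≤ _ := by rw [mul_one]; exact hm
  have h4 : (β * e + ρ) ^ 2 ≤ ((B + R) * e) ^ 2 := by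
    rw [← sq_abs]; gcongr
  have h5 : -((β * e + ρ) * b * e) ≤ (B + R) * e * e := by
    rw [← neg_mul]
    gcongr
    exact (neg_le_abs _).trans h3
  have h6 := (neg_le_abs _).trans h2
  rw [e3] at h1
  simp only [e2, e3]
  have e4 : x - w = (x - z) - (β * e + ρ) := by rw [hρ]; ring
  rw [e4]
  nlinarith

lemma m_sum_upd {N : ℕ} (f : Fin N → ℝ) (k : Fin N) (a : ℝ) :
    ∑ l, (if l = k then a else f l) = ∑ l, f l + (a - f k) := by
  have : ∀ l, (if l = k then a else f l) = f l + (if l = k then a - f k else 0) := by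
    intro l; split_ifs with h
    · rw [h]; ring
    · ring
  simp_rw [this, Finset.sum_add_distrib]
  simp

/-- deterministic quantities -/
noncomputable def mD (s : ℝ) {N : ℕ} (χ : Fin N → ℝ) : ℝ := (∑ l, χ l) + (1 + s) * ((N:ℝ) - ∑ l, χ l)
noncomputable def mq (s : ℝ) {N : ℕ} (χ : Fin N → ℝ) (k : Fin N) : ℝ := (1 + s * (1 - χ k)) / mD s χ
noncomputable def mp (s : ℝ) {N : ℕ} (χ : Fin N → ℝ) (t : Fin N × Fin N × Fin N) : ℝ :=
  (1 / (N:ℝ) ^ 2) * mq s χ t.2.2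
def dY {N : ℕ} (χ : Fin N → ℝ) (t : Fin N × Fin N × Fin N) : ℝ := χ t.1 - χ t.2.2
noncomputable def dU {N : ℕ} (χ X : Fin N → ℝ) (t : Fin N × Fin N × Fin N) : ℝ :=
  χ t.1 * ((X t.1 + X t.2.1) / 2) - χ t.2.2 * X t.2.2

section det
variable {N : ℕ} {s : ℝ} {χ X : Fin N → ℝ}

lemma m_card_le (hχ : ∀ l, χ l = 0 ∨ χ l = 1) : 0 ≤ ∑ l, χ l ∧ ∑ l, χ l ≤ N := by
  constructor
  · exact Finset.sum_nonneg fun l _ => by rcases hχ l with h | h <;> rw [h] <;> norm_num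
  · calc _ ≤ ∑ l : Fin N, (1:ℝ) := Finset.sum_le_sum fun l _ => by rcases hχ l with h | h <;> rw [h] <;> norm_num
      _ = N := by simp

lemma mD_pos (hN : 0 < N) (hs : 0 < s) (hχ : ∀ l, χ l = 0 ∨ χ l = 1) : 0 < mD s χ := by
  obtain ⟨h1, h2⟩ := m_card_le hχ
  have : (0:ℝ) < N := by exact_mod_cast hN
  unfold mD
  nlinarith

lemma mD_eq (hN : 0 < N) : mD s χ = N * (1 + s * (1 - (∑ l, χ l) / N)) := by
  have : (0:ℝ) < N := by exact_mod_cast hN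
  unfold mD
  field_simp
  ring

lemma mq_nonneg (hN : 0 < N) (hs : 0 < s) (hχ : ∀ l, χ l = 0 ∨ χ l = 1) (k : Fin N) : 0 ≤ mq s χ k := by
  have := mD_pos hN hs hχ
  unfold mq
  rcases hχ k with h | h <;> rw [h] <;> apply div_nonneg <;> nlinarith

lemma mq_sum (hN : 0 < N) (hs : 0 < s) (hχ : ∀ l, χ l = 0 ∨ χ l = 1) : ∑ k, mq s χ k = 1 := by
  have := mD_pos hN hs hχ
  unfold mq
  rw [← Finset.sum_div, div_eq_one_iff_eq this.ne', Finset.sum_add_distrib, ← Finset.mul_sum, Finset.sum_sub_distrib]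
  unfold mD
  simp
  ring

lemma mp_sum (hN : 0 < N) (hs : 0 < s) (hχ : ∀ l, χ l = 0 ∨ χ l = 1) (A : Fin N → Fin N → ℝ) (B : Fin N → ℝ) :
    ∑ t, mp s χ t * (A t.1 t.2.1 + B t.2.2) = (1 / (N:ℝ) ^ 2) * (∑ i, ∑ j, A i j) + ∑ k, mq s χ k * B k := by
  have hN' : (0:ℝ) < N := by exact_mod_cast hN
  have hq := mq_sum hN hs hχ
  simp only [mp, Fintype.sum_prod_type]
  have : ∀ i j, ∑ k, 1 / (N:ℝ) ^ 2 * mq s χ k * (A i j + B k) = 1 / (N:ℝ) ^ 2 * A i j + 1 / (N:ℝ)^2 * ∑ k, mq s χ k * B k := by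
    intro i j
    have e : ∀ k, 1 / (N:ℝ) ^ 2 * mq s χ k * (A i j + B k) = mq s χ k * (1 / (N:ℝ) ^ 2 * A i j) + 1 / (N:ℝ)^2 * (mq s χ k * B k) := by
      intro k; ring
    simp_rw [e]
    rw [Finset.sum_add_distrib, ← Finset.sum_mul, hq, one_mul, ← Finset.mul_sum]
  simp_rw [this, Finset.sum_add_distrib, ← Finset.mul_sum]
  simp
  field_simp

lemma mp_sum_one (hN : 0 < N) (hs : 0 < s) (hχ : ∀ l, χ l = 0 ∨ χ l = 1) : ∑ t, mp s χ t = 1 := by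
  have hN' : (0:ℝ) < N := by exact_mod_cast hN
  have := mp_sum hN hs hχ (fun _ _ => 1) (fun _ => 0)
  simp at this
  rw [this]
  field_simp

lemma mp_nonneg (hN : 0 < N) (hs : 0 < s) (hχ : ∀ l, χ l = 0 ∨ χ l = 1) (t) : 0 ≤ mp s χ t :=
  mul_nonneg (by positivity) (mq_nonneg hN hs hχ _)

lemma mp_le_one (hN : 0 < N) (hs : 0 < s) (hχ : ∀ l, χ l = 0 ∨ χ l = 1) (t) : mp s χ t ≤ 1 := by
  rw [← mp_sum_one hN hs hχ]
  exact Finset.single_le_sum (f := mp s χ) (fun t _ => mp_nonneg hN hs hχ t) (Finset.mem_univ t)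

lemma mp_dY (hN : 0 < N) (hs : 0 < s) (hχ : ∀ l, χ l = 0 ∨ χ l = 1) :
    ∑ t, mp s χ t * dY χ t = mB1 s ((∑ l, χ l) / N) := by
  have hN' : (0:ℝ) < N := by exact_mod_cast hN
  have := mp_sum hN hs hχ (fun i _ => χ i) (fun k => - χ k)
  simp only [← sub_eq_add_neg] at this
  unfold dY
  rw [this]
  have e : ∀ k, mq s χ k * -χ k = -(χ k / mD s χ) := by
    intro k; unfold mq; rcases hχ k with h | h <;> rw [h] <;> ring
  simp_rw [e]
  rw [Finset.sum_neg_distrib, ← Finset.sum_div, mD_eq hN, mB1]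
  simp only [Finset.sum_const, Finset.card_univ, Fintype.card_fin, nsmul_eq_mul, ← Finset.mul_sum]
  rw [div_div]
  field_simp
  ring

lemma mp_dU (hN : 0 < N) (hs : 0 < s) (hχ : ∀ l, χ l = 0 ∨ χ l = 1) :
    ∑ t, mp s χ t * dU χ X t = mB2 s ((∑ l, χ l) / N) ((∑ l, χ l * X l) / N) ((∑ l, (1 - χ l) * X l) / N) := by
  have hN' : (0:ℝ) < N := by exact_mod_cast hN
  have := mp_sum hN hs hχ (fun i j => χ i * ((X i + X j) / 2)) (fun k => - (χ k * X k))
  simp only [← sub_eq_add_neg] at this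
  unfold dU
  rw [this]
  have e : ∀ k, mq s χ k * -(χ k * X k) = -(χ k * X k / mD s χ) := by
    intro k; unfold mq; rcases hχ k with h | h <;> rw [h] <;> ring
  simp_rw [e]
  have e2 : ∀ i, ∑ j, χ i * ((X i + X j) / 2) = (N:ℝ) / 2 * (χ i * X i) + χ i * ((∑ j, X j) / 2) := by
    intro i
    rw [← Finset.mul_sum, ← Finset.sum_div, Finset.sum_add_distrib]
    simp
    ring
  simp_rw [e2]
  rw [Finset.sum_neg_distrib, ← Finset.sum_div, mD_eq hN, mB2, Finset.sum_add_distrib, ← Finset.mul_sum, ← Finset.sum_mul]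
  have e3 : ∑ j, X j = ∑ l, χ l * X l + ∑ l, (1 - χ l) * X l := by
    rw [← Finset.sum_add_distrib]; exact Finset.sum_congr rfl fun _ _ => by ring
  rw [e3, ← div_div (∑ l, χ l * X l)]
  generalize (∑ l, χ l * X l) / N / _ = T
  field_simp
  ring

lemma mp_dV (hN : 0 < N) (hs : 0 < s) (hχ : ∀ l, χ l = 0 ∨ χ l = 1) :
    ∑ t, mp s χ t * dU (fun l => 1 - χ l) X t = mB3 s ((∑ l, χ l) / N) ((∑ l, χ l * X l) / N) ((∑ l, (1 - χ l) * X l) / N) := by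
  have hN' : (0:ℝ) < N := by exact_mod_cast hN
  have := mp_sum hN hs hχ (fun i j => (1 - χ i) * ((X i + X j) / 2)) (fun k => - ((1 - χ k) * X k))
  simp only [← sub_eq_add_neg] at this
  unfold dU
  rw [this]
  have e : ∀ k, mq s χ k * -((1 - χ k) * X k) = -((1 + s) * ((1 - χ k) * X k / mD s χ)) := by
    intro k; unfold mq; rcases hχ k with h | h <;> rw [h] <;> ring
  simp_rw [e]
  have e2 : ∀ i, ∑ j, (1 - χ i) * ((X i + X j) / 2) = (N:ℝ) / 2 * ((1 - χ i) * X i) + (1 - χ i) * ((∑ j, X j) / 2) := by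
    intro i
    rw [← Finset.mul_sum, ← Finset.sum_div, Finset.sum_add_distrib]
    simp
    ring
  simp_rw [e2]
  rw [Finset.sum_neg_distrib, ← Finset.mul_sum, ← Finset.sum_div, mD_eq hN, mB3, Finset.sum_add_distrib, ← Finset.mul_sum, ← Finset.sum_mul]
  have e3 : ∑ j, X j = ∑ l, χ l * X l + ∑ l, (1 - χ l) * X l := by
    rw [← Finset.sum_add_distrib]; exact Finset.sum_congr rfl fun _ _ => by ring
  have e4 : ∑ j, (1 - χ j) = N - ∑ j, χ j := by simp
  rw [e3, e4, ← div_div (∑ l, (1 - χ l) * X l)]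
  generalize (∑ l, (1 - χ l) * X l) / N / _ = T
  field_simp
  ring

lemma dY_abs (hχ : ∀ l, χ l = 0 ∨ χ l = 1) (t) : |dY χ t| ≤ 1 := by
  unfold dY
  rcases hχ t.1 with h | h <;> rcases hχ t.2.2 with h' | h' <;> rw [h, h'] <;> norm_num

lemma dU_abs (hχ : ∀ l, χ l = 0 ∨ χ l = 1) (hX : ∀ l, X l ∈ Set.Icc (0:ℝ) 1) (t) : |dU χ X t| ≤ 1 := by
  unfold dU
  have h1 := hX t.1
  have h2 := hX t.2.1
  have h3 := hX t.2.2
  rcases hχ t.1 with h | h <;> rcases hχ t.2.2 with h' | h' <;> rw [h, h', abs_le] <;>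
    constructor <;> linarith [h1.1, h1.2, h2.1, h2.2, h3.1, h3.2]

lemma m_not (hχ : ∀ l, χ l = 0 ∨ χ l = 1) (l) : 1 - χ l = 0 ∨ 1 - χ l = 1 := by
  rcases hχ l with h | h <;> rw [h] <;> norm_num

lemma m_y_mem (hN : 0 < N) (hχ : ∀ l, χ l = 0 ∨ χ l = 1) : (∑ l, χ l) / N ∈ Set.Icc (0:ℝ) 1 := by
  have hN' : (0:ℝ) < N := by exact_mod_cast hN
  obtain ⟨h1, h2⟩ := m_card_le hχ
  exact ⟨by positivity, by rw [div_le_one hN']; exact h2⟩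

lemma m_u_mem (hN : 0 < N) (hχ : ∀ l, χ l = 0 ∨ χ l = 1) (hX : ∀ l, X l ∈ Set.Icc (0:ℝ) 1) :
    (∑ l, χ l * X l) / N ∈ Set.Icc (0:ℝ) 1 := by
  have hN' : (0:ℝ) < N := by exact_mod_cast hN
  obtain ⟨h1, h2⟩ := m_card_le hχ
  have h3 : 0 ≤ ∑ l, χ l * X l := Finset.sum_nonneg fun l _ => by
    rcases hχ l with h | h <;> rw [h] <;> linarith [(hX l).1]
  have h4 : ∑ l, χ l * X l ≤ ∑ l, χ l := Finset.sum_le_sum fun l _ => by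
    rcases hχ l with h | h <;> rw [h] <;> linarith [(hX l).2]
  exact ⟨by positivity, by rw [div_le_one hN']; linarith⟩

/-- squared distance after a jump -/
noncomputable def mPhi (χ X : Fin N → ℝ) (w1 w2 w3 : ℝ) (t : Fin N × Fin N × Fin N) : ℝ :=
  ((∑ l, χ l) / N + dY χ t / N - w1) ^ 2 + ((∑ l, χ l * X l) / N + dU χ X t / N - w2) ^ 2 +
    ((∑ l, (1 - χ l) * X l) / N + dU (fun l => 1 - χ l) X t / N - w3) ^ 2
noncomputable def mQ (χ X : Fin N → ℝ) (w1 w2 w3 : ℝ) : ℝ :=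
  ((∑ l, χ l) / N - w1) ^ 2 + ((∑ l, χ l * X l) / N - w2) ^ 2 +
    ((∑ l, (1 - χ l) * X l) / N - w3) ^ 2

noncomputable def mC (s : ℝ) : ℝ := 3 * (2 * mK s + (3 + s + mK s + 1) ^ 2)

lemma m_abs_sub_le {x z : ℝ} (hx : x ∈ Set.Icc (0:ℝ) 1) (hz : z ∈ Set.Icc (0:ℝ) 1) : |x - z| ≤ 1 := by
  rw [abs_le]; constructor <;> linarith [hx.1, hx.2, hz.1, hz.2]

lemma m_alg {L n C d1 d2 d3 e1 e2 e3 : ℝ} (hL : 0 ≤ L) (hn : 0 < n)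
    (h1 : |e1| ≤ L * (|d1| + |d2| + |d3|)) (h2 : |e2| ≤ L * (|d1| + |d2| + |d3|))
    (h3 : |e3| ≤ L * (|d1| + |d2| + |d3|)) :
    (d1 ^ 2 + 2 * (d1 * e1) / n + C / n ^ 2) + (d2 ^ 2 + 2 * (d2 * e2) / n + C / n ^ 2) +
      (d3 ^ 2 + 2 * (d3 * e3) / n + C / n ^ 2) ≤
    (1 + 6 * L / n) * (d1 ^ 2 + d2 ^ 2 + d3 ^ 2) + 3 * C / n ^ 2 := by
  have k : ∀ d e : ℝ, |e| ≤ L * (|d1| + |d2| + |d3|) → d * e ≤ |d| * (L * (|d1| + |d2| + |d3|)) := by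
    intro d e h
    refine (le_abs_self _).trans ?_
    rw [abs_mul]
    gcongr
  have k1 := k d1 e1 h1
  have k2 := k d2 e2 h2
  have k3 := k d3 e3 h3
  have q : (|d1| + |d2| + |d3|) ^ 2 ≤ 3 * (d1 ^ 2 + d2 ^ 2 + d3 ^ 2) := by
    rw [← sq_abs d1, ← sq_abs d2, ← sq_abs d3]
    nlinarith [sq_nonneg (|d1| - |d2|), sq_nonneg (|d1| - |d3|), sq_nonneg (|d2| - |d3|)]
  have q2 := mul_le_mul_of_nonneg_left q hL
  have tot : d1 * e1 + d2 * e2 + d3 * e3 ≤ 3 * L * (d1 ^ 2 + d2 ^ 2 + d3 ^ 2) := by nlinarith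
  have := div_le_div_of_nonneg_right tot hn.le
  have e : 6 * L / n * (d1 ^ 2 + d2 ^ 2 + d3 ^ 2) = 2 * (3 * L * (d1 ^ 2 + d2 ^ 2 + d3 ^ 2) / n) := by ring
  rw [add_mul, e]
  have e' : 3 * C / n ^ 2 = 3 * (C / n ^ 2) := by ring
  have e'' : 2 * (d1 * e1) / n + 2 * (d2 * e2) / n + 2 * (d3 * e3) / n = 2 * ((d1 * e1 + d2 * e2 + d3 * e3) / n) := by ring
  linarith

lemma m_step (hN : 0 < N) (hs : 0 < s) (hχ : ∀ l, χ l = 0 ∨ χ l = 1) (hX : ∀ l, X l ∈ Set.Icc (0:ℝ) 1)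
    {f g h : ℝ → ℝ} (S : MSol s f g h) {t : ℝ} (ht : 0 ≤ t) :
    ∑ i, mp s χ i * mPhi χ X (f (t + 1 / N)) (g (t + 1 / N)) (h (t + 1 / N)) i ≤
      (1 + 6 * mL s / N) * mQ χ X (f t) (g t) (h t) + mC s / (N:ℝ) ^ 2 := by
  have hN' : (0:ℝ) < N := by exact_mod_cast hN
  have hN1 : (1:ℝ) ≤ N := by exact_mod_cast hN
  have hL : 0 ≤ mL s := by unfold mL; positivity
  have hK : 0 ≤ mK s := by unfold mK; positivity
  obtain ⟨T1, T2, T3⟩ := S.taylor hs ht (e := 1 / N) (by positivity)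
  obtain ⟨B1, B2, B3⟩ := mB_bd hs (S.c1 t ht) (S.c2 t ht) (S.c3 t ht)
  have hy := m_y_mem hN hχ
  have hu := m_u_mem hN hχ hX
  have hv := m_u_mem hN (m_not hχ) hX
  have p0 := mp_nonneg hN hs hχ
  have p1 := mp_sum_one hN hs hχ
  have k1 := mCoord (mp s χ) (dY χ) p0 p1 (dY_abs hχ) (mp_dY hN hs hχ) hN1
    (m_abs_sub_le hy (S.c1 t ht)) B1 hK T1
  have k2 := mCoord (mp s χ) (dU χ X) p0 p1 (dU_abs hχ hX) (mp_dU hN hs hχ) hN1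
    (m_abs_sub_le hu (S.c2 t ht)) B2 hK T2
  have k3 := mCoord (mp s χ) (dU (fun l => 1 - χ l) X) p0 p1 (dU_abs (m_not hχ) hX) (mp_dV hN hs hχ) hN1
    (m_abs_sub_le hv (S.c3 t ht)) B3 hK T3
  have l1 := mB1_lip (u := (∑ l, χ l * X l) / N) (u' := g t) (v := (∑ l, (1 - χ l) * X l) / N)
    (v' := h t) hs hy (S.c1 t ht)
  have l2 := mB2_lip (v' := h t) hs hy (S.c1 t ht) hu (S.c2 t ht) hv
  have l3 := mB3_lip (u' := g t) hs hy (S.c1 t ht) hu hv (S.c3 t ht)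
  unfold mPhi mQ mC
  simp_rw [mul_add (mp s χ _)]
  rw [Finset.sum_add_distrib, Finset.sum_add_distrib]
  refine (add_le_add (add_le_add k1 k2) k3).trans ?_
  exact m_alg hL hN' l1 l2 l3
end det
section prob
variable {N : ℕ} {s : ℝ} {Ω : Type} [MeasurableSpace Ω]

def MoranModel.chi (M : MoranModel N s Ω) (n : ℕ) (ω : Ω) (l : Fin N) : ℝ := if l ∈ M.Y n ω then 1 else 0
def MoranModel.R (M : MoranModel N s Ω) (n : ℕ) (ω : Ω) (l : Fin N) : ℝ := ∑ l' ∈ M.Y 0 ω, M.W n ω l l'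
def MoranModel.T (M : MoranModel N s Ω) (n : ℕ) (ω : Ω) : Fin N × Fin N × Fin N := (M.mo n ω, M.fa n ω, M.ka n ω)

variable (M : MoranModel N s Ω)

lemma MoranModel.chi_01 (n ω l) : M.chi n ω l = 0 ∨ M.chi n ω l = 1 := by
  unfold MoranModel.chi; split_ifs <;> simp

lemma MoranModel.chi_sum (n ω) : ∑ l, M.chi n ω l = ((M.Y n ω).card : ℝ) := by
  simp [MoranModel.chi]

lemma MoranModel.U_eq (n ω) : M.U n ω = ∑ l, M.chi n ω l * M.R n ω l := by
  simp [MoranModel.chi, MoranModel.U, MoranModel.R, ite_mul]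

lemma MoranModel.V_eq (n ω) : M.V n ω = ∑ l, (1 - M.chi n ω l) * M.R n ω l := by
  have : ∀ l, (1 - M.chi n ω l) * M.R n ω l = if l ∈ (M.Y n ω)ᶜ then M.R n ω l else 0 := by
    intro l
    unfold MoranModel.chi
    by_cases h : l ∈ M.Y n ω <;> simp [h]
  simp_rw [this]
  rw [Finset.sum_ite_mem, Finset.univ_inter]
  rfl

lemma MoranModel.chi_succ (n ω l) : M.chi (n+1) ω l = if l = M.ka n ω then M.chi n ω (M.mo n ω) else M.chi n ω l := by
  unfold MoranModel.chi
  rw [M.Y_rec]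
  by_cases h : M.mo n ω ∈ M.Y n ω <;> by_cases h' : l = M.ka n ω <;> simp [h, h']

lemma MoranModel.R_succ (n ω l) : M.R (n+1) ω l =
    if l = M.ka n ω then (M.R n ω (M.mo n ω) + M.R n ω (M.fa n ω)) / 2 else M.R n ω l := by
  unfold MoranModel.R
  simp_rw [M.W_rec]
  split_ifs with h
  · rw [← Finset.sum_add_distrib, ← Finset.sum_div]
  · rfl

lemma MoranModel.R_zero (ω l) : M.R 0 ω l = M.chi 0 ω l := by
  simp [MoranModel.R, M.W_init, MoranModel.chi]

lemma MoranModel.R_mem (n ω) : ∀ l, M.R n ω l ∈ Set.Icc (0:ℝ) 1 := by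
  induction n with
  | zero => intro l; rw [M.R_zero]; rcases M.chi_01 0 ω l with h | h <;> rw [h] <;> simp
  | succ n ih =>
    intro l
    rw [M.R_succ]
    split_ifs
    · have h1 := ih (M.mo n ω)
      have h2 := ih (M.fa n ω)
      constructor <;> linarith [h1.1, h1.2, h2.1, h2.2]
    · exact ih l

lemma MoranModel.y_succ (n ω) : ∑ l, M.chi (n+1) ω l = ∑ l, M.chi n ω l + dY (M.chi n ω) (M.T n ω) := by
  simp_rw [M.chi_succ]
  rw [m_sum_upd]; rfl

lemma MoranModel.u_succ (n ω) : ∑ l, M.chi (n+1) ω l * M.R (n+1) ω l =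
    ∑ l, M.chi n ω l * M.R n ω l + dU (M.chi n ω) (M.R n ω) (M.T n ω) := by
  have : ∀ l, M.chi (n+1) ω l * M.R (n+1) ω l = if l = M.ka n ω then M.chi n ω (M.mo n ω) *
    ((M.R n ω (M.mo n ω) + M.R n ω (M.fa n ω)) / 2) else M.chi n ω l * M.R n ω l := by
    intro l; rw [M.chi_succ, M.R_succ]; split_ifs <;> rfl
  simp_rw [this]
  rw [m_sum_upd]; rfl

lemma MoranModel.v_succ (n ω) : ∑ l, (1 - M.chi (n+1) ω l) * M.R (n+1) ω l =
    ∑ l, (1 - M.chi n ω l) * M.R n ω l + dU (fun l => 1 - M.chi n ω l) (M.R n ω) (M.T n ω) := by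
  have : ∀ l, (1 - M.chi (n+1) ω l) * M.R (n+1) ω l = if l = M.ka n ω then (1 - M.chi n ω (M.mo n ω)) *
    ((M.R n ω (M.mo n ω) + M.R n ω (M.fa n ω)) / 2) else (1 - M.chi n ω l) * M.R n ω l := by
    intro l; rw [M.chi_succ, M.R_succ]; split_ifs <;> rfl
  simp_rw [this]
  rw [m_sum_upd]; rfl

lemma MoranModel.Q_succ (n ω w1 w2 w3) : mQ (M.chi (n+1) ω) (M.R (n+1) ω) w1 w2 w3 =
    mPhi (M.chi n ω) (M.R n ω) w1 w2 w3 (M.T n ω) := by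
  unfold mQ mPhi
  rw [M.y_succ, M.u_succ, M.v_succ]
  simp only [add_div]

/-- measurability -/
lemma MoranModel.F_le (n) : M.F n ≤ ‹MeasurableSpace Ω› := by
  refine iSup₂_le fun k _ => sup_le (M.meas_W k).comap_le ?_
  rintro _ ⟨A, _, rfl⟩
  exact M.meas_Y k A

lemma MoranModel.W_le {k n : ℕ} (h : k ≤ n) : MeasurableSpace.comap (M.W k) inferInstance ≤ M.F n :=
  le_sup_left.trans (le_iSup₂_of_le (f := fun k (_ : k ∈ Set.Iic n) =>
    (MeasurableSpace.comap (M.W k) inferInstance ⊔ MeasurableSpace.comap (M.Y k) ⊤)) k h le_rfl)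

lemma MoranModel.Y_le {k n : ℕ} (h : k ≤ n) : MeasurableSpace.comap (M.Y k) ⊤ ≤ M.F n :=
  le_sup_right.trans (le_iSup₂_of_le (f := fun k (_ : k ∈ Set.Iic n) =>
    (MeasurableSpace.comap (M.W k) inferInstance ⊔ MeasurableSpace.comap (M.Y k) ⊤)) k h le_rfl)

lemma MoranModel.chi_meas {k n : ℕ} (h : k ≤ n) (l) : Measurable[M.F n] (fun ω => M.chi k ω l) := by
  unfold MoranModel.chi
  refine Measurable.ite ?_ measurable_const measurable_const
  exact M.Y_le h _ ⟨{S | l ∈ S}, trivial, rfl⟩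

lemma MoranModel.R_meas (n : ℕ) (l) : Measurable[M.F n] (fun ω => M.R n ω l) := by
  have e : (fun ω => M.R n ω l) = fun ω => ∑ l', M.chi 0 ω l' * M.W n ω l l' := by
    ext ω; simp [MoranModel.chi, MoranModel.R, ite_mul]
  rw [e]
  refine Finset.measurable_fun_sum _ fun l' _ => ?_
  refine Measurable.mul (M.chi_meas (Nat.zero_le n) l') ?_
  have hW : Measurable[M.F n] (M.W n) := measurable_iff_comap_le.2 (M.W_le le_rfl)
  exact (measurable_pi_apply l').comp ((measurable_pi_apply l).comp hW)

lemma MoranModel.Phi_meas (n : ℕ) (w1 w2 w3 t) :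
    Measurable[M.F n] (fun ω => mPhi (M.chi n ω) (M.R n ω) w1 w2 w3 t) := by
  have hc := fun l => M.chi_meas (le_refl n) l
  have hR := fun l => M.R_meas n l
  have h1 : ∀ l, Measurable[M.F n] (fun ω => 1 - M.chi n ω l) := fun l => measurable_const.sub (hc l)
  have s1 : Measurable[M.F n] (fun ω => ∑ l, M.chi n ω l) := Finset.measurable_fun_sum _ fun l _ => hc l
  have s2 : Measurable[M.F n] (fun ω => ∑ l, M.chi n ω l * M.R n ω l) :=
    Finset.measurable_fun_sum _ fun l _ => (hc l).mul (hR l)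
  have s3 : Measurable[M.F n] (fun ω => ∑ l, (1 - M.chi n ω l) * M.R n ω l) :=
    Finset.measurable_fun_sum _ fun l _ => (h1 l).mul (hR l)
  have a1 : Measurable[M.F n] (fun ω => dY (M.chi n ω) t) := (hc _).sub (hc _)
  have a2 : Measurable[M.F n] (fun ω => dU (M.chi n ω) (M.R n ω) t) :=
    ((hc _).mul (((hR _).add (hR _)).div_const 2)).sub ((hc _).mul (hR _))
  have a3 : Measurable[M.F n] (fun ω => dU (fun l => 1 - M.chi n ω l) (M.R n ω) t) :=
    ((h1 _).mul (((hR _).add (hR _)).div_const 2)).sub ((h1 _).mul (hR _))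
  unfold mPhi
  exact (((((s1.div_const _).add (a1.div_const _)).sub_const _).pow_const 2).add
    ((((s2.div_const _).add (a2.div_const _)).sub_const _).pow_const 2)).add
    ((((s3.div_const _).add (a3.div_const _)).sub_const _).pow_const 2)

lemma MoranModel.Q_meas (n : ℕ) (w1 w2 w3) :
    Measurable[M.F n] (fun ω => mQ (M.chi n ω) (M.R n ω) w1 w2 w3) := by
  have hc := fun l => M.chi_meas (le_refl n) l
  have hR := fun l => M.R_meas n l
  have h1 : ∀ l, Measurable[M.F n] (fun ω => 1 - M.chi n ω l) := fun l => measurable_const.sub (hc l)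
  have s1 : Measurable[M.F n] (fun ω => ∑ l, M.chi n ω l) := Finset.measurable_fun_sum _ fun l _ => hc l
  have s2 : Measurable[M.F n] (fun ω => ∑ l, M.chi n ω l * M.R n ω l) :=
    Finset.measurable_fun_sum _ fun l _ => (hc l).mul (hR l)
  have s3 : Measurable[M.F n] (fun ω => ∑ l, (1 - M.chi n ω l) * M.R n ω l) :=
    Finset.measurable_fun_sum _ fun l _ => (h1 l).mul (hR l)
  unfold mQ
  exact ((((s1.div_const _).sub_const _).pow_const 2).add
    (((s2.div_const _).sub_const _).pow_const 2)).add
    (((s3.div_const _).sub_const _).pow_const 2)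

lemma MoranModel.p_meas (n : ℕ) (t) : Measurable[M.F n] (fun ω => mp s (M.chi n ω) t) := by
  have hc := fun l => M.chi_meas (le_refl n) l
  have s1 : Measurable[M.F n] (fun ω => ∑ l, M.chi n ω l) := Finset.measurable_fun_sum _ fun l _ => hc l
  unfold mp mq mD
  exact ((((measurable_const.sub (hc _)).const_mul s).const_add 1).div
    (s1.add ((measurable_const.sub s1).const_mul (1 + s)))).const_mul _

lemma MoranModel.p_eq (n ω t) : mp s (M.chi n ω) t = (1 / (N:ℝ)^2) * ((1 + s * (if t.2.2 ∈ M.Y n ω then 0 else 1)) /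
            (((M.Y n ω).card : ℝ) + (1 + s) * ((N : ℝ) - ((M.Y n ω).card : ℝ)))) := by
  unfold mp mq mD
  rw [M.chi_sum]
  unfold MoranModel.chi
  by_cases h : t.2.2 ∈ M.Y n ω <;> simp [h]

lemma MoranModel.T_meas (n t) : MeasurableSet {ω | M.T n ω = t} := by
  have : Measurable (M.T n) := (M.meas_mo n).prodMk ((M.meas_fa n).prodMk (M.meas_ka n))
  exact this (measurableSet_singleton t)

lemma MoranModel.p_condExp (hN : 0 < N) (hs : 0 < s) (n t) :
    (fun ω => mp s (M.chi n ω) t) =ᵐ[M.P] M.P[({ω | M.T n ω = t}).indicator (fun _ => (1:ℝ)) | M.F n] := by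
  have := M.isProb
  have hint : Integrable (fun ω => mp s (M.chi n ω) t) M.P := by
    refine Integrable.of_bound ((M.p_meas n t).mono (M.F_le n) le_rfl).aestronglyMeasurable 1 (Eventually.of_forall fun ω => ?_)
    rw [Real.norm_eq_abs, abs_of_nonneg (mp_nonneg hN hs (M.chi_01 n ω) t)]
    exact mp_le_one hN hs (M.chi_01 n ω) t
  refine ae_eq_condExp_of_forall_setIntegral_eq (M.F_le n) ?_ ?_ ?_ ?_
  · exact (integrable_const (1:ℝ)).indicator (M.T_meas n t)
  · intro A _ _; exact hint.integrableOn
  · intro A hA _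
    rw [setIntegral_indicator (M.T_meas n t), setIntegral_const, smul_eq_mul, mul_one]
    have := M.law n A hA t.1 t.2.1 t.2.2
    have e : {ω | M.T n ω = t} = {ω | M.mo n ω = t.1 ∧ M.fa n ω = t.2.1 ∧ M.ka n ω = t.2.2} := by
      ext ω; simp [MoranModel.T, Prod.ext_iff]
    rw [e, Measure.real, this, ← integral_const_mul]
    simp_rw [M.p_eq]
  · exact (M.p_meas n t).stronglyMeasurable.aestronglyMeasurable

lemma MoranModel.expect (hN : 0 < N) (hs : 0 < s) (n : ℕ) (Φ : Fin N × Fin N × Fin N → Ω → ℝ) {C : ℝ}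
    (hm : ∀ t, Measurable[M.F n] (Φ t)) (hC : ∀ t ω, |Φ t ω| ≤ C) :
    ∫ ω, Φ (M.T n ω) ω ∂M.P = ∫ ω, ∑ t, mp s (M.chi n ω) t * Φ t ω ∂M.P := by
  have := M.isProb
  have hΦ : ∀ t, AEStronglyMeasurable (Φ t) M.P := fun t => ((hm t).mono (M.F_le n) le_rfl).aestronglyMeasurable
  have e : ∀ ω, Φ (M.T n ω) ω = ∑ t, Φ t ω * ({ω | M.T n ω = t}).indicator (fun _ => (1:ℝ)) ω := by
    intro ω
    rw [Finset.sum_eq_single (M.T n ω)]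
    · simp
    · intro t _ ht
      simp [Set.indicator, ht.symm]
    · simp
  have hi : ∀ t, Integrable (({ω | M.T n ω = t}).indicator (fun _ => (1:ℝ))) M.P :=
    fun t => (integrable_const (1:ℝ)).indicator (M.T_meas n t)
  have hint : ∀ t, Integrable (fun ω => mp s (M.chi n ω) t) M.P := fun t => by
    refine Integrable.of_bound ((M.p_meas n t).mono (M.F_le n) le_rfl).aestronglyMeasurable 1 (Eventually.of_forall fun ω => ?_)
    rw [Real.norm_eq_abs, abs_of_nonneg (mp_nonneg hN hs (M.chi_01 n ω) t)]
    exact mp_le_one hN hs (M.chi_01 n ω) t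
  have i1 : ∀ t, Integrable (Φ t * ({ω | M.T n ω = t}).indicator (fun _ => (1:ℝ))) M.P := fun t =>
    (hi t).bdd_mul (hΦ t) (Eventually.of_forall (hC t))
  have i1' : ∀ t, Integrable (fun ω => Φ t ω * ({ω | M.T n ω = t}).indicator (fun _ => (1:ℝ)) ω) M.P := fun t => i1 t
  have i2 : ∀ t, Integrable (fun ω => mp s (M.chi n ω) t * Φ t ω) M.P := fun t =>
    (hint t).mul_bdd (hΦ t) (Eventually.of_forall (hC t))
  simp_rw [e]
  rw [integral_finsetSum _ (fun t _ => i1' t), integral_finsetSum _ (fun t _ => i2 t)]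
  refine Finset.sum_congr rfl fun t _ => ?_
  have h1 := condExp_mul_of_stronglyMeasurable_left (hm t).stronglyMeasurable (i1 t) (hi t)
  have h2 := integral_condExp (μ := M.P) (f := Φ t * ({ω | M.T n ω = t}).indicator (fun _ => (1:ℝ))) (M.F_le n)
  change ∫ ω, (Φ t * ({ω | M.T n ω = t}).indicator (fun _ => (1:ℝ))) ω ∂M.P = _
  rw [← h2]
  refine integral_congr_ae ?_
  filter_upwards [h1, M.p_condExp hN hs n t] with ω a b
  rw [a, Pi.mul_apply, ← b, mul_comm]

lemma MoranModel.Q_bd (hN : 0 < N) (n ω) {w1 w2 w3 : ℝ} (h1 : w1 ∈ Set.Icc (0:ℝ) 1) (h2 : w2 ∈ Set.Icc (0:ℝ) 1)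
    (h3 : w3 ∈ Set.Icc (0:ℝ) 1) : |mQ (M.chi n ω) (M.R n ω) w1 w2 w3| ≤ 3 := by
  have a1 := m_abs_sub_le (m_y_mem hN (M.chi_01 n ω)) h1
  have a2 := m_abs_sub_le (m_u_mem hN (M.chi_01 n ω) (M.R_mem n ω)) h2
  have a3 := m_abs_sub_le (m_u_mem hN (m_not (M.chi_01 n ω)) (M.R_mem n ω)) h3
  rw [← sq_le_one_iff_abs_le_one] at a1 a2 a3
  unfold mQ
  rw [abs_of_nonneg (by positivity)]
  linarith

lemma MoranModel.Q_int (hN : 0 < N) (n) {w1 w2 w3 : ℝ} (h1 : w1 ∈ Set.Icc (0:ℝ) 1) (h2 : w2 ∈ Set.Icc (0:ℝ) 1)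
    (h3 : w3 ∈ Set.Icc (0:ℝ) 1) : Integrable (fun ω => mQ (M.chi n ω) (M.R n ω) w1 w2 w3) M.P := by
  have := M.isProb
  exact Integrable.of_bound ((M.Q_meas n _ _ _).mono (M.F_le n) le_rfl).aestronglyMeasurable 3
    (Eventually.of_forall fun ω => M.Q_bd hN n ω h1 h2 h3)

lemma MoranModel.e_succ (hN : 0 < N) (hs : 0 < s) {f g h : ℝ → ℝ} (S : MSol s f g h) {t : ℝ} (ht : 0 ≤ t) (n : ℕ) :
    ∫ ω, mQ (M.chi (n+1) ω) (M.R (n+1) ω) (f (t + 1 / N)) (g (t + 1 / N)) (h (t + 1 / N)) ∂M.P ≤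
     (1 + 6 * mL s / N) * (∫ ω, mQ (M.chi n ω) (M.R n ω) (f t) (g t) (h t) ∂M.P) + mC s / (N:ℝ) ^ 2 := by
  have := M.isProb
  have hN1 : (1:ℝ) ≤ N := by exact_mod_cast hN
  have ht' : 0 ≤ t + 1 / N := by positivity
  have w1 := S.c1 _ ht'
  have w2 := S.c2 _ ht'
  have w3 := S.c3 _ ht'
  set z1 := f (t + 1 / N)
  set z2 := g (t + 1 / N)
  set z3 := h (t + 1 / N)
  have hb : ∀ i ω, |mPhi (M.chi n ω) (M.R n ω) z1 z2 z3 i| ≤ 12 := by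
    intro i ω
    have aux : ∀ x z d : ℝ, x ∈ Set.Icc (0:ℝ) 1 → z ∈ Set.Icc (0:ℝ) 1 → |d| ≤ 1 → (x + d / N - z) ^ 2 ≤ 4 := by
      intro x z d hx hz hd
      have : |d / N| ≤ 1 := by
        rw [abs_div, abs_of_pos (by linarith : (0:ℝ) < N)]
        exact (div_le_self (abs_nonneg _) hN1).trans hd
      have h2 : |x + d / N - z| ≤ 2 := by
        rw [abs_le] at this ⊢
        constructor <;> linarith [hx.1, hx.2, hz.1, hz.2, this.1, this.2]
      rw [← sq_abs]; nlinarith [abs_nonneg (x + d / N - z)]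
    have a1 := aux _ _ _ (m_y_mem hN (M.chi_01 n ω)) w1 (dY_abs (M.chi_01 n ω) i)
    have a2 := aux _ _ _ (m_u_mem hN (M.chi_01 n ω) (M.R_mem n ω)) w2 (dU_abs (M.chi_01 n ω) (M.R_mem n ω) i)
    have a3 := aux _ _ _ (m_u_mem hN (m_not (M.chi_01 n ω)) (M.R_mem n ω)) w3 (dU_abs (m_not (M.chi_01 n ω)) (M.R_mem n ω) i)
    unfold mPhi
    rw [abs_of_nonneg (by positivity)]
    linarith
  simp_rw [M.Q_succ]
  rw [M.expect hN hs n (fun i ω => mPhi (M.chi n ω) (M.R n ω) z1 z2 z3 i) (fun i => M.Phi_meas n _ _ _ i) hb]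
  have hQ := M.Q_int hN n (S.c1 t ht) (S.c2 t ht) (S.c3 t ht)
  have e : (1 + 6 * mL s / N) * (∫ ω, mQ (M.chi n ω) (M.R n ω) (f t) (g t) (h t) ∂M.P) + mC s / (N:ℝ) ^ 2 =
      ∫ ω, ((1 + 6 * mL s / N) * mQ (M.chi n ω) (M.R n ω) (f t) (g t) (h t) + mC s / (N:ℝ) ^ 2) ∂M.P := by
    rw [integral_add (hQ.const_mul _) (integrable_const _), integral_const_mul]
    simp
  rw [e]
  refine integral_mono ?_ ((hQ.const_mul _).add (integrable_const _)) fun ω => ?_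
  · refine integrable_finsetSum _ fun i _ => ?_
    refine Integrable.of_bound (((M.p_meas n i).mul (M.Phi_meas n _ _ _ i)).mono (M.F_le n) le_rfl).aestronglyMeasurable 12
      (Eventually.of_forall fun ω => ?_)
    rw [norm_mul, Real.norm_eq_abs, Real.norm_eq_abs, abs_of_nonneg (mp_nonneg hN hs (M.chi_01 n ω) i)]
    calc _ ≤ 1 * (12:ℝ) := by
          gcongr
          · exact mp_le_one hN hs (M.chi_01 n ω) i
          · exact hb i ω
      _ = _ := one_mul _
  · exact m_step hN hs (M.chi_01 n ω) (M.R_mem n ω) S ht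

lemma MoranModel.e_bound (hN : 0 < N) (hs : 0 < s) {f g h : ℝ → ℝ} (S : MSol s f g h) {a : ℝ} (ha : 0 ≤ a)
    (hf0 : f 0 = a) (hg0 : g 0 = a) (hh0 : h 0 = 0)
    (hY0 : ∀ ω, (M.Y 0 ω).card = ⌊a * N⌋₊) (n : ℕ) :
    ∫ ω, mQ (M.chi n ω) (M.R n ω) (f (n / N)) (g (n / N)) (h (n / N)) ∂M.P ≤
     (1 + 6 * mL s / N) ^ n * ((2 + n * mC s) / (N:ℝ) ^ 2) := by
  have := M.isProb
  have hN' : (0:ℝ) < N := by exact_mod_cast hN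
  have hL : 0 ≤ mL s := by unfold mL; positivity
  have hK : 0 ≤ mK s := by unfold mK; positivity
  have hC : 0 ≤ mC s := by unfold mC; positivity
  induction n with
  | zero =>
    have : ∀ ω, mQ (M.chi 0 ω) (M.R 0 ω) (f 0) (g 0) (h 0) ≤ 2 / (N:ℝ)^2 := by
      intro ω
      have e1 : ∑ l, M.chi 0 ω l * M.R 0 ω l = (M.Y 0 ω).card := by
        rw [← M.chi_sum]
        refine Finset.sum_congr rfl fun l _ => ?_
        rw [M.R_zero]; rcases M.chi_01 0 ω l with h | h <;> rw [h] <;> norm_num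
      have e2 : ∑ l, (1 - M.chi 0 ω l) * M.R 0 ω l = 0 := by
        refine Finset.sum_eq_zero fun l _ => ?_
        rw [M.R_zero]; rcases M.chi_01 0 ω l with h | h <;> rw [h] <;> norm_num
      unfold mQ
      rw [e1, e2, M.chi_sum, hY0, hf0, hg0, hh0]
      have b1 := Nat.floor_le (by positivity : 0 ≤ a * N)
      have b2 := Nat.lt_floor_add_one (a * N)
      have b3 : ((⌊a * N⌋₊ : ℝ) / N - a) ^ 2 ≤ 1 / (N:ℝ)^2 := by
        have : (⌊a * N⌋₊ : ℝ) / N - a = (⌊a * N⌋₊ - a * N) / N := by field_simp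
        rw [this, div_pow]
        gcongr
        nlinarith
      have e3 : 2 / (N:ℝ)^2 = 1 / (N:ℝ)^2 + 1 / (N:ℝ)^2 := by ring
      rw [e3]
      simp only [zero_div, sub_zero]
      linarith
    simp only [Nat.cast_zero, zero_div, pow_zero, one_mul, zero_mul, add_zero]
    have hQ := M.Q_int hN 0 (S.c1 0 le_rfl) (S.c2 0 le_rfl) (S.c3 0 le_rfl)
    calc _ ≤ ∫ ω, 2 / (N:ℝ)^2 ∂M.P := integral_mono hQ (integrable_const _) this
      _ = _ := by simp
  | succ n ih =>
    have k := M.e_succ hN hs S (t := n / N) (by positivity) n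
    have e : ((n + 1 : ℕ) : ℝ) / N = n / N + 1 / N := by push_cast; ring
    rw [e]
    refine k.trans ?_
    have hA : 1 ≤ 1 + 6 * mL s / N := by
      have : 0 ≤ 6 * mL s / N := by positivity
      linarith
    have hA' : 1 ≤ (1 + 6 * mL s / N) ^ (n + 1) := one_le_pow₀ hA
    calc _ ≤ (1 + 6 * mL s / N) * ((1 + 6 * mL s / N) ^ n * ((2 + n * mC s) / (N:ℝ) ^ 2)) + (1 + 6 * mL s / N) ^ (n + 1) * (mC s / (N:ℝ)^2) := by
          gcongr
          exact le_mul_of_one_le_left (by positivity) hA'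
      _ = _ := by push_cast; ring

lemma m_walk {x : ℕ → ℝ} {e : ℝ} (h : ∀ n, |x (n+1) - x n| ≤ e) (m n : ℕ) : |x m - x n| ≤ e * |(m:ℝ) - n| := by
  have aux : ∀ n k : ℕ, |x (n + k) - x n| ≤ e * k := by
    intro n k
    induction k with
    | zero => simp
    | succ k ih =>
      have := h (n + k)
      have e1 : x (n + (k + 1)) - x n = (x (n + k + 1) - x (n + k)) + (x (n + k) - x n) := by
        rw [← add_assoc]; ring
      rw [e1]
      refine (abs_add_le _ _).trans ?_
      push_cast
      linarith
  rcases le_total n m with hm | hm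
  · obtain ⟨k, rfl⟩ := Nat.exists_eq_add_of_le hm
    have := aux n k
    push_cast
    rwa [add_sub_cancel_left, abs_of_nonneg (by positivity : (0:ℝ) ≤ k)]
  · obtain ⟨k, rfl⟩ := Nat.exists_eq_add_of_le hm
    have := aux m k
    push_cast
    rwa [abs_sub_comm, abs_sub_comm (m:ℝ), add_sub_cancel_left, abs_of_nonneg (by positivity : (0:ℝ) ≤ k)]

lemma m_norm3_le (p : ℝ × ℝ × ℝ) : norm3 p ≤ |p.1| + |p.2.1| + |p.2.2| := by
  unfold norm3
  apply Real.sqrt_le_iff.2 ⟨by positivity, ?_⟩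
  rw [← sq_abs p.1, ← sq_abs p.2.1, ← sq_abs p.2.2]
  nlinarith [mul_nonneg (abs_nonneg p.1) (abs_nonneg p.2.1), mul_nonneg (abs_nonneg p.1) (abs_nonneg p.2.2),
    mul_nonneg (abs_nonneg p.2.1) (abs_nonneg p.2.2)]

lemma MoranModel.Z_lip (hN : 0 < N) (m n : ℕ) (ω : Ω) :
    |(M.Z m ω).1 - (M.Z n ω).1| ≤ 1 / N * |(m:ℝ) - n| ∧
    |(M.Z m ω).2.1 - (M.Z n ω).2.1| ≤ 1 / N * |(m:ℝ) - n| ∧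
    |(M.Z m ω).2.2 - (M.Z n ω).2.2| ≤ 1 / N * |(m:ℝ) - n| := by
  have hN' : (0:ℝ) < N := by exact_mod_cast hN
  refine ⟨m_walk (x := fun n => (M.Z n ω).1) (fun n => ?_) m n, m_walk (x := fun n => (M.Z n ω).2.1) (fun n => ?_) m n,
    m_walk (x := fun n => (M.Z n ω).2.2) (fun n => ?_) m n⟩
  · simp only [MoranModel.Z, ← M.chi_sum]
    rw [M.y_succ, ← sub_div, add_sub_cancel_left, abs_div, abs_of_pos hN']
    gcongr
    exact dY_abs (M.chi_01 n ω) _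
  · simp only [MoranModel.Z, M.U_eq]
    rw [M.u_succ, ← sub_div, add_sub_cancel_left, abs_div, abs_of_pos hN']
    gcongr
    exact dU_abs (M.chi_01 n ω) (M.R_mem n ω) _
  · simp only [MoranModel.Z, M.V_eq]
    rw [M.v_succ, ← sub_div, add_sub_cancel_left, abs_div, abs_of_pos hN']
    gcongr
    exact dU_abs (m_not (M.chi_01 n ω)) (M.R_mem n ω) _

lemma m_tri {A B C D x y z : ℝ} (h1 : |A - B| ≤ x) (h2 : |B - C| ≤ y) (h3 : |C - D| ≤ z) : |A - D| ≤ x + y + z := by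
  have : A - D = (A - B) + (B - C) + (C - D) := by ring
  rw [this]
  exact (abs_add_three _ _ _).trans (by gcongr)

lemma m_hd {d1 d2 d3 e : ℝ} (he : 0 < e) (h : d1 ^ 2 + d2 ^ 2 + d3 ^ 2 < e ^ 2 / 3) : |d1| + |d2| + |d3| ≤ e := by
  apply le_of_sq_le_sq _ he.le
  rw [← sq_abs d1, ← sq_abs d2, ← sq_abs d3] at h
  nlinarith [sq_nonneg (|d1| - |d2|), sq_nonneg (|d1| - |d3|), sq_nonneg (|d2| - |d3|)]

lemma m_fin {A B C x1 x2 x3 q s ε : ℝ} (t1 : A ≤ q + x1 + (3 + s) * q) (t2 : B ≤ q + x2 + (3 + s) * q)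
    (t3 : C ≤ q + x3 + (3 + s) * q) (hd : x1 + x2 + x3 ≤ ε / 4) (hs : 3 * (4 + s) * q ≤ ε / 4) :
    A + B + C ≤ ε / 2 := by
  have : 3 * (4 + s) * q = 3 * (q + (3 + s) * q) := by ring
  linarith

set_option maxHeartbeats 1000000 in
lemma MoranModel.final (hN : 0 < N) (hs : 0 < s) {f g h : ℝ → ℝ} (S : MSol s f g h) {a : ℝ} (ha : 0 ≤ a)
    (hf0 : f 0 = a) (hg0 : g 0 = a) (hh0 : h 0 = 0)
    (hY0 : ∀ ω, (M.Y 0 ω).card = ⌊a * N⌋₊) {c ε : ℝ} (hc : 0 < c) (hε : 0 < ε) (K : ℕ) (hK : 0 < K)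
    (hsmall : 3 * (4 + s) * (c / K + 1 / N) ≤ ε / 4) :
    M.P.real {ω | ε ≤ ⨆ t : Set.Icc (0 : ℝ) c, norm3 (M.Z ⌊(N : ℝ) * (t : ℝ)⌋₊ ω - (f t, g t, h t))} ≤
      (K + 1) * (Real.exp (6 * mL s * c) * ((2 + c * mC s) / N) / ((ε / 4) ^ 2 / 3)) := by
  have := M.isProb
  have hN' : (0:ℝ) < N := by exact_mod_cast hN
  have hN1 : (1:ℝ) ≤ N := by exact_mod_cast hN
  have hK' : (0:ℝ) < K := by exact_mod_cast hK
  have hL : 0 ≤ mL s := by unfold mL; positivity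
  have hKK : 0 ≤ mK s := by unfold mK; positivity
  have hC : 0 ≤ mC s := by unfold mC; positivity
  set η := (ε / 4) ^ 2 / 3 with hη
  have hη0 : 0 < η := by positivity
  let nk : ℕ → ℕ := fun k => ⌊(N:ℝ) * (k * (c / K))⌋₊
  let bad : ℕ → Set Ω := fun n => {ω | η ≤ mQ (M.chi n ω) (M.R n ω) (f (n / N)) (g (n / N)) (h (n / N))}
  have hsub : {ω | ε ≤ ⨆ t : Set.Icc (0 : ℝ) c, norm3 (M.Z ⌊(N : ℝ) * (t : ℝ)⌋₊ ω - (f t, g t, h t))} ⊆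
      ⋃ k ∈ Finset.range (K + 1), bad (nk k) := by
    intro ω hω
    by_contra hcon
    simp only [Set.mem_iUnion, not_exists, bad, Set.mem_ofPred_eq, not_le] at hcon
    have hne : Nonempty (Set.Icc (0:ℝ) c) := ⟨⟨0, le_rfl, hc.le⟩⟩
    have : (⨆ t : Set.Icc (0 : ℝ) c, norm3 (M.Z ⌊(N : ℝ) * (t : ℝ)⌋₊ ω - (f t, g t, h t))) ≤ ε / 2 := by
      refine ciSup_le fun t => ?_
      obtain ⟨t, ht0, htc⟩ := t
      simp only
      set k := ⌊t / (c / K)⌋₊ with hk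
      have hcK : 0 < c / K := by positivity
      have hk1 : (k:ℝ) * (c / K) ≤ t := by
        rw [← le_div_iff₀ hcK]; exact Nat.floor_le (by positivity)
      have hk2 : t ≤ (k:ℝ) * (c / K) + c / K := by
        have := (Nat.lt_floor_add_one (t / (c / K))).le
        rw [div_le_iff₀ hcK] at this
        rw [← hk] at this
        linarith
      have hkK : k ≤ K := by
        have h1 : (k:ℝ) * (c / K) ≤ c := hk1.trans htc
        have h2 : (k:ℝ) * (c / K) = (k / K) * c := by ring
        rw [h2] at h1
        have h3 : (k:ℝ) / K ≤ 1 := by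
          by_contra h
          push Not at h
          nlinarith
        rw [div_le_one hK'] at h3
        exact_mod_cast h3
      have hQ := hcon k (Finset.mem_range.2 (by omega))
      have hnk : nk k = ⌊(N:ℝ) * (k * (c / K))⌋₊ := rfl
      set n := nk k with hn
      set m := ⌊(N:ℝ) * t⌋₊ with hm
      have m1 : (m:ℝ) ≤ N * t := Nat.floor_le (by positivity)
      have m2 : (N:ℝ) * t < m + 1 := Nat.lt_floor_add_one _
      have n1 : (n:ℝ) ≤ N * (k * (c / K)) := by rw [hnk]; exact Nat.floor_le (by positivity)
      have n2 : (N:ℝ) * (k * (c / K)) < n + 1 := by rw [hnk]; exact Nat.lt_floor_add_one _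
      have hmn : 1 / N * |(m:ℝ) - n| ≤ c / K + 1 / N := by
        have : |(m:ℝ) - n| ≤ N * (c / K) + 1 := by
          have q1 : (N:ℝ) * (k * (c / K)) ≤ N * t := by gcongr
          have q2 : (N:ℝ) * t ≤ N * (k * (c / K) + c / K) := by gcongr
          have q3 : 0 ≤ (N:ℝ) * (c / K) := by positivity
          rw [mul_add] at q2
          rw [abs_le]
          constructor <;> linarith
        calc _ ≤ 1 / (N:ℝ) * (N * (c / K) + 1) := by gcongr
          _ = _ := by field_simp
      have hnt : |(n:ℝ) / N - t| ≤ c / K + 1 / N := by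
        have e1 : (n:ℝ) / N ≤ k * (c / K) := by rw [div_le_iff₀ hN']; linarith
        have e2 : (k:ℝ) * (c / K) ≤ (n:ℝ) / N + 1 / N := by
          rw [← add_div, le_div_iff₀ hN']; linarith
        rw [abs_le]
        constructor <;> linarith [show 0 < 1 / (N:ℝ) by positivity]
      obtain ⟨z1, z2, z3⟩ := M.Z_lip hN m n ω
      obtain ⟨s1, s2, s3⟩ := S.lip hs ht0 (r := (n:ℝ) / N) (by positivity)
      have hs' : (3 + s) * |(n:ℝ) / N - t| ≤ (3 + s) * (c / K + 1 / N) := by gcongr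
      have t1 := m_tri (z1.trans hmn) (le_refl |(M.Z n ω).1 - f (n / N)|) (s1.trans hs')
      have t2 := m_tri (z2.trans hmn) (le_refl |(M.Z n ω).2.1 - g (n / N)|) (s2.trans hs')
      have t3 := m_tri (z3.trans hmn) (le_refl |(M.Z n ω).2.2 - h (n / N)|) (s3.trans hs')
      refine (m_norm3_le _).trans ?_
      simp only [Prod.fst_sub, Prod.snd_sub]
      have hQ' : mQ (M.chi n ω) (M.R n ω) (f (n / N)) (g (n / N)) (h (n / N)) =
        ((M.Z n ω).1 - f (n / N)) ^ 2 + ((M.Z n ω).2.1 - g (n / N)) ^ 2 + ((M.Z n ω).2.2 - h (n / N)) ^ 2 := by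
        simp only [mQ, MoranModel.Z, M.U_eq, M.V_eq, M.chi_sum]
      rw [hQ'] at hQ
      exact m_fin t1 t2 t3 (m_hd (by positivity) hQ) hsmall
    have h2 : ε ≤ ε / 2 := le_trans hω this
    linarith
  refine (measureReal_mono hsub (measure_ne_top _ _)).trans ((measureReal_biUnion_finset_le _ _).trans ?_)
  have each : ∀ k ∈ Finset.range (K + 1), M.P.real (bad (nk k)) ≤ Real.exp (6 * mL s * c) * ((2 + c * mC s) / N) / η := by
    intro k hk
    have hkK : (k:ℝ) ≤ K := by
      have : k ≤ K := by simpa [Nat.lt_succ_iff] using hk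
      exact_mod_cast this
    set n := nk k with hn
    have hnk : n = ⌊(N:ℝ) * (k * (c / K))⌋₊ := rfl
    have n1 : (n:ℝ) ≤ N * c := by
      have : (n:ℝ) ≤ N * (k * (c / K)) := by rw [hnk]; exact Nat.floor_le (by positivity)
      refine this.trans ?_
      gcongr
      calc (k:ℝ) * (c / K) ≤ K * (c / K) := by gcongr
        _ = c := by field_simp
    have hn0 : (0:ℝ) ≤ n / N := by positivity
    have mk := mul_meas_ge_le_integral_of_nonneg (μ := M.P)
      (f := fun ω => mQ (M.chi n ω) (M.R n ω) (f (n / N)) (g (n / N)) (h (n / N)))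
      (Eventually.of_forall fun ω => by simp only [Pi.zero_apply, mQ]; positivity)
      (M.Q_int hN n (S.c1 _ hn0) (S.c2 _ hn0) (S.c3 _ hn0)) η
    have eb := M.e_bound hN hs S ha hf0 hg0 hh0 hY0 n
    rw [le_div_iff₀ hη0, mul_comm]
    refine (mk.trans eb).trans (mul_le_mul ?_ ?_ (by positivity) (by positivity))
    · calc (1 + 6 * mL s / N) ^ n ≤ (Real.exp (6 * mL s / N)) ^ n := by
            gcongr
            rw [add_comm]; exact Real.add_one_le_exp _
        _ = Real.exp (n * (6 * mL s / N)) := by rw [← Real.exp_nat_mul]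
        _ ≤ _ := by
            apply Real.exp_le_exp.2
            calc (n:ℝ) * (6 * mL s / N) ≤ (N * c) * (6 * mL s / N) := by gcongr
              _ = _ := by field_simp
    · rw [div_le_div_iff₀ (by positivity) hN']
      have : (n:ℝ) * mC s ≤ N * c * mC s := by gcongr
      have h2 : 2 + n * mC s ≤ N * (2 + c * mC s) := by nlinarith
      calc (2 + n * mC s) * (N:ℝ) ≤ (N * (2 + c * mC s)) * N := by gcongr
        _ = _ := by ring
  refine (Finset.sum_le_sum each).trans ?_
  simp
end prob

/-- **Main theorem.**  Suppose that initially `Y₀ = ⌊aN⌋` with `a ∈ (0,1)`.  Let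
`y : t ↦ F⁻¹(a^{1+s}/(1−a) eˢᵗ)` where `F : x ↦ x^{1+s}/(1−x)` maps `[0,1)` onto `[0,∞)`
(characterized by `y t ∈ [0,1)` and `F (y t) = a^{1+s}/(1−a) eˢᵗ`), and let
`z t = (y t, u t, v t)` with `u, v` given by the explicit formulas `uval`, `vval`.
Then for every `c > 0`, `sup_{0 ≤ t ≤ c} ‖Z_{⌊Nt⌋} − z_t‖ → 0` in probability as `N → ∞`.
(The population size is written `N + 2` so that it ranges over the integers `≥ 2`.) -/
theorem moran_rescaled_process_tendsto_dynamical_system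
    (s a : ℝ) (hs : 0 < s) (ha : a ∈ Set.Ioo (0 : ℝ) 1)
    (Ω : ℕ → Type) [∀ N, MeasurableSpace (Ω N)]
    (M : ∀ N : ℕ, MoranModel (N + 2) s (Ω N))
    (hY0 : ∀ N ω, ((M N).Y 0 ω).card = ⌊a * ((N : ℝ) + 2)⌋₊)
    (y : ℝ → ℝ)
    (hy : ∀ t : ℝ, 0 ≤ t → y t ∈ Set.Ico (0 : ℝ) 1 ∧
      (y t) ^ (1 + s) / (1 - y t) = a ^ (1 + s) / (1 - a) * Real.exp (s * t))
    (c : ℝ) (hc : 0 < c) :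
    ∀ ε : ℝ, 0 < ε →
      Tendsto (fun N : ℕ =>
          (M N).P {ω | ε ≤ ⨆ t : Set.Icc (0 : ℝ) c,
            norm3 ((M N).Z ⌊((N : ℝ) + 2) * (t : ℝ)⌋₊ ω -
              (y t, uval s a (y t), vval s a (y t)))})
        atTop (nhds 0) := by


  obtain ⟨f, g, h, he, d1, d2, d3, hc', hf0, hg0, hh0⟩ := mODE s a hs ha y hy
  have S : MSol s f g h := ⟨d1, d2, d3, fun t ht => (hc' t ht).1, fun t ht => (hc' t ht).2.1, fun t ht => (hc' t ht).2.2⟩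
  intro ε hε
  have hset : ∀ N ω, (⨆ t : Set.Icc (0 : ℝ) c,
            norm3 ((M N).Z ⌊((N : ℝ) + 2) * (t : ℝ)⌋₊ ω -
              (y t, uval s a (y t), vval s a (y t)))) = ⨆ t : Set.Icc (0 : ℝ) c,
            norm3 ((M N).Z ⌊(((N + 2 : ℕ) : ℝ)) * (t : ℝ)⌋₊ ω - (f t, g t, h t)) := by
    intro N ω
    refine iSup_congr fun t => ?_
    obtain ⟨e1, e2, e3⟩ := he t t.2.1
    rw [e2, e3, e1]
    push_cast
    rfl
  simp_rw [hset]
  have hs4 : 0 < 3 * (4 + s) := by positivity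
  obtain ⟨K, hK⟩ := exists_nat_gt (3 * (4 + s) * c * 8 / ε)
  have hK0 : (0:ℝ) < K := lt_of_le_of_lt (by positivity) hK
  have hN2 : Tendsto (fun N : ℕ => (((N + 2 : ℕ) : ℝ))) atTop atTop :=
    tendsto_natCast_atTop_atTop.comp (tendsto_add_atTop_nat 2)
  have hinv : Tendsto (fun N : ℕ => 1 / (((N + 2 : ℕ) : ℝ))) atTop (nhds 0) := by
    simp only [one_div]
    exact hN2.inv_tendsto_atTop
  have hlim : Tendsto (fun N : ℕ => ENNReal.ofReal
      ((K + 1) * (Real.exp (6 * mL s * c) * ((2 + c * mC s) / ((N + 2 : ℕ) : ℝ)) / ((ε / 4) ^ 2 / 3)))) atTop (nhds 0) := by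
    rw [← ENNReal.ofReal_zero]
    apply ENNReal.tendsto_ofReal
    have := hinv.const_mul ((K + 1) * (Real.exp (6 * mL s * c) * (2 + c * mC s) / ((ε / 4) ^ 2 / 3)))
    rw [mul_zero] at this
    refine this.congr fun N => ?_
    ring
  refine tendsto_of_tendsto_of_tendsto_of_le_of_le' tendsto_const_nhds hlim
    (Eventually.of_forall fun _ => zero_le) ?_
  have hev : ∀ᶠ N : ℕ in atTop, 1 / (((N + 2 : ℕ) : ℝ)) < ε / (8 * (3 * (4 + s))) :=
    hinv.eventually_lt_const (by positivity)
  filter_upwards [hev] with N hN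
  have := (M N).isProb
  have key := (M N).final (by omega) hs S ha.1.le hf0 hg0 hh0 (fun ω => by rw [hY0]; push_cast; rfl) hc hε K
    (by exact_mod_cast hK0) (by
      have h1 : 3 * (4 + s) * (c / K) ≤ ε / 8 := by
        rw [div_lt_iff₀ hε] at hK
        rw [← mul_div_assoc, div_le_iff₀ hK0]
        nlinarith
      have h2 : 3 * (4 + s) * (1 / ((N + 2 : ℕ) : ℝ)) ≤ ε / 8 := by
        calc _ ≤ 3 * (4 + s) * (ε / (8 * (3 * (4 + s)))) := by gcongr
          _ = _ := by field_simp
      rw [mul_add]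
      linarith)
  rw [← ofReal_measureReal]
  exact ENNReal.ofReal_le_ofReal key
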